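/- arXiv:2112.00159 — 2 statements merged into one kernel-verified Lean document; each statement's English description precedes it below -/
import Mathlib

section
/- For every n ≥ 1 and every walk W ∈ W^n_sb, the semi-Baxter permutation obtained from W via the generating-tree bijection coincides with the permutation obtained from the associated coalescent-walk process: pw⁻¹(W) = cpp(wcp_sb(W)). In particular, the diagram pw⁻¹ = cpp ∘ wcp_sb commutes on W^n_sb. -/
attribute [local instance] Classical.propDecidable

noncomputable section

/-- `appendVal l m` is the permutation `σ^{*m}`: append a new final value `m`
and shift up by one all values `≥ m`. Permutations of size `n` are encoded as the
list of values `[σ(1),…,σ(n)]`. -/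
def appendVal (l : List ℕ) (m : ℕ) : List ℕ :=
  (l.map fun v => if m ≤ v then v + 1 else v) ++ [m]

/-- Avoidance of the vincular pattern 2-41-3 (indices 0-based). -/
def IsSemiBaxter (l : List ℕ) : Prop :=
  ¬ ∃ i j k : ℕ, i < j ∧ j + 1 < k ∧ k < l.length ∧
    (l.getD (j+1) 0 < l.getD i 0 ∧ l.getD i 0 < l.getD k 0 ∧ l.getD k 0 < l.getD j 0)

/-- The active sites of `l`: those `m ∈ [1, n+1]` with `σ^{*m}` semi-Baxter. -/
def activeSites (l : List ℕ) : Finset ℕ :=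
  (Finset.Icc 1 (l.length + 1)).filter fun m => IsSemiBaxter (appendVal l m)

/-- The last value `σ(n)` of the permutation. -/
def lastVal (l : List ℕ) : ℕ := l.getLast?.getD 0

/-- The active sites `s_{-x} < … < s_0`, i.e. those `≤ σ(n)`, in increasing order. -/
def belowSites (l : List ℕ) : List ℕ :=
  ((activeSites l).filter fun m => m ≤ lastVal l).sort (· ≤ ·)

/-- The active sites `s_1 < … < s_{y+1}`, i.e. those `> σ(n)`, in increasing order. -/
def aboveSites (l : List ℕ) : List ℕ :=
  ((activeSites l).filter fun m => lastVal l < m).sort (· ≤ ·)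

/-- One step of the generating-tree bijection `pw⁻¹` for semi-Baxter permutations:
for an increment `(i, -i+1)` with `i ≥ 1` insert at `s_i`, and for `(-i, 1)` with
`i ≥ 0` insert at `s_{-i}`. -/
def nextPerm (l : List ℕ) (d : ℤ × ℤ) : List ℕ :=
  if 1 ≤ d.1 then appendVal l ((aboveSites l).getD (d.1.toNat - 1) 0)
  else appendVal l ((belowSites l).getD ((belowSites l).length - 1 - (-d.1).toNat) 0)

/-- `pwInv W m` is `pw⁻¹((W_i)_{i∈[m+1]})`, the semi-Baxter permutation of size `m+1`
associated with the first `m+1` points of the walk `W` (points are indexed from `0`). -/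
def pwInv (W : ℕ → ℤ × ℤ) : ℕ → List ℕ
  | 0 => [1]
  | k + 1 => nextPerm (pwInv W k) (W (k+1) - W k)

/-- One step of the coalescent-walk process `wcp_sb` for semi-Baxter permutations,
driven by the increment `d = (ΔX, ΔY)`. -/
def zStep (z : ℤ) (d : ℤ × ℤ) : ℤ :=
  if 0 ≤ z ∧ 0 < z + d.2 then z + d.2
  else if (0 ≤ z ∧ z + d.2 ≤ 0) ∨ (z < 0 ∧ z - d.1 < 0) then z - d.1
  else 1

/-- The walk `Z^{(t)}` of the coalescent-walk process `wcp_sb(W)`. -/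
def zWalk (W : ℕ → ℤ × ℤ) (t : ℕ) : ℕ → ℤ
  | 0 => 0
  | ℓ + 1 => if ℓ + 1 ≤ t then 0 else zStep (zWalk W t ℓ) (W (ℓ+1) - W ℓ)

/-- The permutation `cpp(wcp_sb(W))` of size `n`:
`σ(j) = #{i ∈ [j] : Z^{(i)}_j ≤ 0} + #{i ∈ [j+1,n] : Z^{(j)}_i > 0}` (here 0-indexed). -/
def cpp (W : ℕ → ℤ × ℤ) (n : ℕ) : List ℕ :=
  (List.range n).map fun j =>
    ((Finset.range (j+1)).filter fun i => zWalk W i j ≤ 0).card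
      + ((Finset.Icc (j+1) (n-1)).filter fun i => 0 < zWalk W j i).card

/-- The increment set `I_sb = {(-i,1) : i ≥ 0} ∪ {(i,-i+1) : i ≥ 1}`. -/
def ISemi : Set (ℤ × ℤ) :=
  {d | (d.1 ≤ 0 ∧ d.2 = 1) ∨ (1 ≤ d.1 ∧ d.2 = 1 - d.1)}

/-- `W^n_sb`: `n`-point walks in `ℤ²_{≥0}` starting at `(0,0)` with increments in `I_sb`. -/
def IsWalkSemi (n : ℕ) (W : ℕ → ℤ × ℤ) : Prop :=
  W 0 = (0, 0) ∧ (∀ k, k < n → 0 ≤ (W k).1 ∧ 0 ≤ (W k).2) ∧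
    ∀ k, k + 1 < n → W (k+1) - W k ∈ ISemi

/-- The shift applied to old values when appending `m`. -/
def shiftVal (m v : ℕ) : ℕ := if m ≤ v then v + 1 else v

lemma shiftVal_cases (m v : ℕ) : (m ≤ v ∧ shiftVal m v = v + 1) ∨ (v < m ∧ shiftVal m v = v) := by
  unfold shiftVal
  by_cases h : m ≤ v
  · simp [h]
  · right; simp [h]; omega

lemma length_appendVal (l : List ℕ) (m : ℕ) : (appendVal l m).length = l.length + 1 := by
  simp [appendVal]

lemma getD_appendVal_lt (l : List ℕ) (m j : ℕ) (h : j < l.length) :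
    (appendVal l m).getD j 0 = shiftVal m (l.getD j 0) := by
  simp [appendVal, List.getD_eq_getElem?_getD, List.getElem?_append, h, shiftVal]

lemma getD_appendVal_len (l : List ℕ) (m : ℕ) :
    (appendVal l m).getD l.length 0 = m := by
  simp [appendVal, List.getD_eq_getElem?_getD]

lemma lastVal_appendVal (l : List ℕ) (m : ℕ) : lastVal (appendVal l m) = m := by
  simp [appendVal, lastVal]

lemma lastVal_eq (l : List ℕ) (k : ℕ) (h : l.length = k + 1) : lastVal l = l.getD k 0 := by
  simp [lastVal, List.getLast?_eq_getElem?, h]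

/-- Explicit description of active sites. -/
def Act (l : List ℕ) (t : ℕ) : Prop :=
  ∀ i j, i < j → j + 1 < l.length →
    ¬ (l.getD (j+1) 0 < l.getD i 0 ∧ l.getD i 0 < t ∧ t ≤ l.getD j 0)

lemma isSemiBaxter_appendVal (l : List ℕ) (m : ℕ) :
    IsSemiBaxter (appendVal l m) ↔ IsSemiBaxter l ∧ Act l m := by
  unfold IsSemiBaxter Act
  rw [length_appendVal]
  constructor
  · intro h
    refine ⟨?_, ?_⟩
    · rintro ⟨i, j, k, hij, hjk, hk, h1, h2, h3⟩
      apply h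
      refine ⟨i, j, k, hij, hjk, by omega, ?_⟩
      rw [getD_appendVal_lt _ _ _ (by omega : i < l.length),
        getD_appendVal_lt _ _ _ (by omega : j < l.length),
        getD_appendVal_lt _ _ _ (by omega : j + 1 < l.length),
        getD_appendVal_lt _ _ _ hk]
      have := shiftVal_cases m (l.getD i 0)
      have := shiftVal_cases m (l.getD j 0)
      have := shiftVal_cases m (l.getD (j+1) 0)
      have := shiftVal_cases m (l.getD k 0)
      omega
    · rintro i j hij hj ⟨h1, h2, h3⟩
      apply h
      refine ⟨i, j, l.length, hij, hj, by omega, ?_⟩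
      rw [getD_appendVal_lt _ _ _ (by omega : i < l.length),
        getD_appendVal_lt _ _ _ (by omega : j < l.length),
        getD_appendVal_lt _ _ _ (by omega : j + 1 < l.length),
        getD_appendVal_len]
      have := shiftVal_cases m (l.getD i 0)
      have := shiftVal_cases m (l.getD j 0)
      have := shiftVal_cases m (l.getD (j+1) 0)
      omega
  · rintro ⟨hl, ha⟩ ⟨i, j, k, hij, hjk, hk, h⟩
    rw [getD_appendVal_lt _ _ _ (by omega : i < l.length),
        getD_appendVal_lt _ _ _ (by omega : j < l.length),
        getD_appendVal_lt _ _ _ (by omega : j + 1 < l.length)] at h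
    have := shiftVal_cases m (l.getD i 0)
    have := shiftVal_cases m (l.getD j 0)
    have := shiftVal_cases m (l.getD (j+1) 0)
    rcases Nat.lt_or_ge k l.length with hk' | hk'
    · rw [getD_appendVal_lt _ _ _ hk'] at h
      have := shiftVal_cases m (l.getD k 0)
      exact hl ⟨i, j, k, hij, hjk, hk', by omega⟩
    · have : k = l.length := by omega
      subst this
      rw [getD_appendVal_len] at h
      exact ha i j hij hjk (by omega)

lemma mem_activeSites (l : List ℕ) (hl : IsSemiBaxter l) (t : ℕ) :
    t ∈ activeSites l ↔ (1 ≤ t ∧ t ≤ l.length + 1) ∧ Act l t := by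
  simp only [activeSites, Finset.mem_filter, Finset.mem_Icc, isSemiBaxter_appendVal]
  tauto

/-- Counting form of "being a permutation". -/
def IsPermC (l : List ℕ) : Prop :=
  ∀ m, 1 ≤ m → m ≤ l.length + 1 →
    ((Finset.range l.length).filter fun j => l.getD j 0 < m).card + 1 = m

lemma IsPermC.surj {l : List ℕ} (h : IsPermC l) {m : ℕ} (h1 : 1 ≤ m) (h2 : m ≤ l.length) :
    ∃ j, j < l.length ∧ l.getD j 0 = m := by
  by_contra! hc
  have a := h m h1 (by omega)
  have b := h (m+1) (by omega) (by omega)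
  have : ((Finset.range l.length).filter fun j => l.getD j 0 < m) =
      ((Finset.range l.length).filter fun j => l.getD j 0 < m + 1) := by
    apply Finset.filter_congr
    intro j hj
    have := hc j (Finset.mem_range.1 hj)
    omega
  rw [this] at a
  omega

lemma IsPermC.append {l : List ℕ} (h : IsPermC l) {m : ℕ} (h1 : 1 ≤ m) (h2 : m ≤ l.length + 1) :
    IsPermC (appendVal l m) := by
  intro t ht1 ht2
  rw [length_appendVal] at ht2 ⊢
  rw [Finset.range_add_one, Finset.filter_insert, getD_appendVal_len]
  rcases Nat.lt_or_ge m t with hmt | hmt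
  · rw [if_pos hmt, Finset.card_insert_of_notMem (by simp)]
    have e : ((Finset.range l.length).filter fun j => (appendVal l m).getD j 0 < t) =
      ((Finset.range l.length).filter fun j => l.getD j 0 < t - 1) := by
      apply Finset.filter_congr
      intro j hj
      rw [getD_appendVal_lt _ _ _ (Finset.mem_range.1 hj)]
      have := shiftVal_cases m (l.getD j 0)
      omega
    rw [e, h (t-1) (by omega) (by omega)]
    omega
  · rw [if_neg (by omega)]
    have e : ((Finset.range l.length).filter fun j => (appendVal l m).getD j 0 < t) =
      ((Finset.range l.length).filter fun j => l.getD j 0 < t) := by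
      apply Finset.filter_congr
      intro j hj
      rw [getD_appendVal_lt _ _ _ (Finset.mem_range.1 hj)]
      have := shiftVal_cases m (l.getD j 0)
      omega
    rw [e, h t (by omega) (by omega)]

lemma IsPermC.le {l : List ℕ} (h : IsPermC l) {j : ℕ} (hj : j < l.length) :
    l.getD j 0 ≤ l.length := by
  have a := h (l.length + 1) (by omega) le_rfl
  have b : ((Finset.range l.length).filter fun j => l.getD j 0 < l.length + 1) =
      Finset.range l.length := by
    apply Finset.eq_of_subset_of_card_le (Finset.filter_subset _ _)
    rw [Finset.card_range]; omega
  have c : j ∈ (Finset.range l.length).filter fun j => l.getD j 0 < l.length + 1 := by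
    rw [b]; exact Finset.mem_range.2 hj
  have := (Finset.mem_filter.1 c).2
  omega

lemma act_append {l : List ℕ} (hp : IsPermC l) (k : ℕ) (hk : l.length = k + 1) {m : ℕ}
    (hm : 1 ≤ m) (ha : Act l m) (t : ℕ) :
    Act (appendVal l m) t ↔ (t ≤ m ∧ Act l t) ∨ t = m + 1 ∨
      (m + 1 < t ∧ lastVal l + 1 < t ∧ Act l (t - 1)) := by
  have hL : lastVal l = l.getD k 0 := lastVal_eq l k hk
  have hLle : lastVal l ≤ l.length := by rw [hL]; exact hp.le (by omega)
  have key : Act (appendVal l m) t ↔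
      (∀ i j, i < j → j + 1 < l.length → ¬ (l.getD (j+1) 0 < l.getD i 0 ∧
        shiftVal m (l.getD i 0) < t ∧ t ≤ shiftVal m (l.getD j 0))) ∧
      (∀ i, i < k → ¬ (m ≤ l.getD i 0 ∧ shiftVal m (l.getD i 0) < t ∧
        t ≤ shiftVal m (lastVal l))) := by
    unfold Act
    rw [length_appendVal]
    constructor
    · intro h
      constructor
      · rintro i j hij hj hh
        refine h i j hij (by omega) ?_
        rw [getD_appendVal_lt _ _ _ (by omega : i < l.length),
          getD_appendVal_lt _ _ _ (by omega : j < l.length),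
          getD_appendVal_lt _ _ _ (by omega : j + 1 < l.length)]
        have := shiftVal_cases m (l.getD i 0)
        have := shiftVal_cases m (l.getD (j+1) 0)
        omega
      · rintro i hi hh
        refine h i k hi (by omega) ?_
        rw [← hk, getD_appendVal_len, getD_appendVal_lt _ _ _ (by omega : i < l.length),
          getD_appendVal_lt _ _ _ (by omega : k < l.length), ← hL]
        have := shiftVal_cases m (l.getD i 0)
        omega
    · rintro ⟨h1, h2⟩ i j hij hj hh
      rw [getD_appendVal_lt _ _ _ (by omega : i < l.length),
          getD_appendVal_lt _ _ _ (by omega : j < l.length)] at hh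
      have := shiftVal_cases m (l.getD i 0)
      rcases Nat.lt_or_ge (j+1) l.length with hj' | hj'
      · rw [getD_appendVal_lt _ _ _ hj'] at hh
        have := shiftVal_cases m (l.getD (j+1) 0)
        exact h1 i j hij hj' (by omega)
      · have hjk : j = k := by omega
        subst hjk
        rw [← hk, getD_appendVal_len, ← hL] at hh
        exact h2 i hij (by omega)
  rw [key]
  rcases lt_trichotomy t (m+1) with ht | ht | ht
  · constructor
    · rintro ⟨h1, -⟩
      refine Or.inl ⟨by omega, fun i j hij hj hh => h1 i j hij hj ?_⟩
      have := shiftVal_cases m (l.getD i 0)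
      have := shiftVal_cases m (l.getD j 0)
      omega
    · rintro (⟨-, h⟩ | h | h)
      · refine ⟨fun i j hij hj hh => h i j hij hj ?_, fun i hi hh => ?_⟩
        · have := shiftVal_cases m (l.getD i 0)
          have := shiftVal_cases m (l.getD j 0)
          omega
        · have := shiftVal_cases m (l.getD i 0)
          omega
      · omega
      · omega
  · refine ⟨fun _ => Or.inr (Or.inl ht), fun _ => ⟨fun i j hij hj hh => ha i j hij hj ?_,
      fun i hi hh => ?_⟩⟩
    · have := shiftVal_cases m (l.getD i 0)
      have := shiftVal_cases m (l.getD j 0)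
      omega
    · have := shiftVal_cases m (l.getD i 0)
      omega
  · constructor
    · rintro ⟨h1, h2⟩
      refine Or.inr (Or.inr ⟨ht, ?_, fun i j hij hj hh => h1 i j hij hj ?_⟩)
      · by_contra hc
        obtain ⟨j, hj, hjm⟩ := hp.surj hm (by omega)
        have hjk : j ≠ k := by
          rintro rfl
          omega
        refine h2 j (by omega) ?_
        have := shiftVal_cases m (l.getD j 0)
        have := shiftVal_cases m (lastVal l)
        omega
      · have := shiftVal_cases m (l.getD i 0)
        have := shiftVal_cases m (l.getD j 0)
        omega
    · rintro (⟨h, -⟩ | h | ⟨-, hl, h⟩)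
      · omega
      · omega
      · refine ⟨fun i j hij hj hh => h i j hij hj ?_, fun i hi hh => ?_⟩
        · have := shiftVal_cases m (l.getD i 0)
          have := shiftVal_cases m (l.getD j 0)
          omega
        · have := shiftVal_cases m (l.getD i 0)
          have := shiftVal_cases m (lastVal l)
          omega

/-- Number of elements of `S` that are at most `v`. -/
def cnt (S : Finset ℕ) (v : ℕ) : ℕ := (S.filter fun a => a ≤ v).card

lemma cnt_mono (S : Finset ℕ) {u v : ℕ} (h : u ≤ v) : cnt S u ≤ cnt S v := by
  apply Finset.card_le_card
  intro a
  simp only [Finset.mem_filter]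
  rintro ⟨h1, h2⟩
  exact ⟨h1, by omega⟩

lemma cnt_lt (S : Finset ℕ) {u v : ℕ} (h : u < v) (hv : v ∈ S) : cnt S u < cnt S v := by
  apply Finset.card_lt_card
  rw [Finset.ssubset_iff_of_subset]
  · exact ⟨v, by simp [hv], by simp; omega⟩
  · intro a
    simp only [Finset.mem_filter]
    rintro ⟨h1, h2⟩
    exact ⟨h1, by omega⟩

lemma cnt_split (S : Finset ℕ) {u v : ℕ} (h : u ≤ v) :
    cnt S v = cnt S u + (S.filter fun a => u < a ∧ a ≤ v).card := by
  unfold cnt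
  rw [← Finset.card_union_of_disjoint]
  · congr 1
    ext a
    simp only [Finset.mem_filter, Finset.mem_union]
    constructor
    · rintro ⟨h1, h2⟩
      by_cases hu : a ≤ u
      · exact Or.inl ⟨h1, hu⟩
      · exact Or.inr ⟨h1, by omega, h2⟩
    · rintro (⟨h1, h2⟩ | ⟨h1, h2, h3⟩)
      · exact ⟨h1, by omega⟩
      · exact ⟨h1, h3⟩
  · rw [Finset.disjoint_left]
    intro a
    simp only [Finset.mem_filter]
    omega

/-- `A` is updated to `A'` after inserting at site `m`, when the last value was `L`. -/
def Upd (A A' : Finset ℕ) (m L : ℕ) : Prop :=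
  ∀ t, t ∈ A' ↔ (t ≤ m ∧ t ∈ A) ∨ t = m + 1 ∨ (m + 1 < t ∧ L + 1 < t ∧ t - 1 ∈ A)

lemma Upd.cnt_le {A A' : Finset ℕ} {m L : ℕ} (h : Upd A A' m L) {v : ℕ} (hv : v ≤ m) :
    cnt A' v = cnt A v := by
  unfold cnt
  congr 1
  ext a
  simp only [Finset.mem_filter, h a]
  constructor
  · rintro ⟨h1 | h1 | h1, h2⟩
    · exact ⟨h1.2, h2⟩
    · omega
    · omega
  · rintro ⟨h1, h2⟩
    exact ⟨Or.inl ⟨by omega, h1⟩, h2⟩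

lemma Upd.cnt_gt {A A' : Finset ℕ} {m L : ℕ} (h : Upd A A' m L) {v : ℕ} (hv : m ≤ v) :
    cnt A' (v + 1) = cnt A m + 1 + (A.filter fun a => max m L < a ∧ a ≤ v).card := by
  rw [cnt_split A' (by omega : m ≤ v + 1), h.cnt_le le_rfl, add_assoc]
  congr 1
  have : (A'.filter fun a => m < a ∧ a ≤ v + 1) =
      insert (m+1) ((A.filter fun a => max m L < a ∧ a ≤ v).image (· + 1)) := by
    ext a
    simp only [Finset.mem_filter, h a, Finset.mem_insert, Finset.mem_image]
    constructor
    · rintro ⟨h1 | h1 | h1, h2⟩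
      · omega
      · exact Or.inl h1
      · exact Or.inr ⟨a - 1, ⟨h1.2.2, by omega, by omega⟩, by omega⟩
    · rintro (h1 | ⟨b, ⟨h1, h2, h3⟩, rfl⟩)
      · exact ⟨Or.inr (Or.inl h1), by omega, by omega⟩
      · exact ⟨Or.inr (Or.inr ⟨by omega, by omega, by simpa using h1⟩), by omega, by omega⟩
  rw [this, Finset.card_insert_of_notMem, Finset.card_image_of_injective _
    (add_left_injective 1), add_comm]
  simp only [Finset.mem_image, Finset.mem_filter]
  rintro ⟨b, ⟨h1, h2, h3⟩, h4⟩
  omega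

lemma Upd.cnt_gt_of_le {A A' : Finset ℕ} {m L : ℕ} (h : Upd A A' m L) {v : ℕ} (hv : m ≤ v)
    (hL : v ≤ L) : cnt A' (v + 1) = cnt A m + 1 := by
  rw [h.cnt_gt hv]
  have : (A.filter fun a => max m L < a ∧ a ≤ v) = ∅ := by
    ext a
    simp only [Finset.mem_filter, Finset.notMem_empty, iff_false]
    omega
  rw [this, Finset.card_empty]

lemma Upd.cnt_gt_of_ge {A A' : Finset ℕ} {m L : ℕ} (h : Upd A A' m L) {v : ℕ} (hv : m ≤ v)
    (hL : L ≤ v) : cnt A' (v + 1) + cnt A (max m L) = cnt A m + 1 + cnt A v := by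
  rw [h.cnt_gt hv, cnt_split A (by omega : max m L ≤ v)]
  omega

lemma sort_getD (S : Finset ℕ) (p : ℕ) (hp : p < S.card) :
    (S.sort (· ≤ ·)).getD p 0 ∈ S ∧ cnt S ((S.sort (· ≤ ·)).getD p 0) = p + 1 := by
  set l := S.sort (· ≤ ·) with hl
  have hlen : l.length = S.card := Finset.length_sort _
  have hget : ∀ q (hq : q < l.length), l.getD q 0 = l[q] := by
    intro q hq
    simp [List.getD_eq_getElem?_getD, hq]
  have hmem : ∀ a, a ∈ S ↔ ∃ q, q < l.length ∧ l.getD q 0 = a := by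
    intro a
    rw [← Finset.mem_sort (· ≤ ·), ← hl, List.mem_iff_getElem]
    constructor
    · rintro ⟨q, hq, h⟩
      exact ⟨q, hq, by rw [hget q hq, h]⟩
    · rintro ⟨q, hq, h⟩
      exact ⟨q, hq, by rw [← hget q hq, h]⟩
  have hmono : ∀ q r, q < r → r < l.length → l.getD q 0 < l.getD r 0 := by
    intro q r hqr hr
    rw [hget q (by omega), hget r hr]
    exact List.pairwise_iff_getElem.1 (Finset.sortedLT_sort S).pairwise q r (hqr.trans hr) hr hqr
  refine ⟨(hmem _).2 ⟨p, by omega, rfl⟩, ?_⟩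
  have : (S.filter fun a => a ≤ l.getD p 0) = (Finset.range (p+1)).image (fun q => l.getD q 0) := by
    ext a
    simp only [Finset.mem_filter, Finset.mem_image, Finset.mem_range, hmem a]
    constructor
    · rintro ⟨⟨q, hq, rfl⟩, h2⟩
      refine ⟨q, ?_, rfl⟩
      by_contra hc
      have := hmono p q (by omega) hq
      omega
    · rintro ⟨q, hq, rfl⟩
      refine ⟨⟨q, by omega, rfl⟩, ?_⟩
      rcases Nat.lt_or_ge q p with h | h
      · exact (hmono q p h (by omega)).le
      · have : q = p := by omega
        rw [this]
  unfold cnt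
  rw [this, Finset.card_image_of_injOn, Finset.card_range]
  intro q hq r hr hqr
  simp only [Finset.coe_range, Set.mem_Iio] at hq hr hqr
  rcases lt_trichotomy q r with h | h | h
  · have := hmono q r h (by omega); omega
  · exact h
  · have := hmono r q h (by omega); omega

/-- The site used by `nextPerm`. -/
lemma nextPerm_eq (l : List ℕ) (d : ℤ × ℤ) (hle : ∀ a ∈ activeSites l, a ≤ l.length + 1)
    (hLl : lastVal l ≤ l.length + 1)
    (h1 : 1 ≤ (cnt (activeSites l) (lastVal l) : ℤ) + d.1)
    (h2 : (cnt (activeSites l) (lastVal l) : ℤ) + d.1 ≤ cnt (activeSites l) (l.length + 1)) :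
    ∃ m, nextPerm l d = appendVal l m ∧ m ∈ activeSites l ∧
      (cnt (activeSites l) m : ℤ) = cnt (activeSites l) (lastVal l) + d.1 := by
  unfold nextPerm
  set A := activeSites l with hA
  set L := lastVal l with hLdef
  by_cases hd : 1 ≤ d.1
  · rw [if_pos hd]
    refine ⟨_, rfl, ?_⟩
    have e : (A.filter fun a => L < a) = (A.filter fun a => L < a ∧ a ≤ l.length + 1) := by
      apply Finset.filter_congr
      intro a ha
      have := hle a ha
      omega
    have hsp := cnt_split A hLl
    rw [← e] at hsp
    obtain ⟨hm, hc⟩ := sort_getD (A.filter fun a => L < a) (d.1.toNat - 1) (by omega)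
    have hab : aboveSites l = (A.filter fun a => L < a).sort (· ≤ ·) := rfl
    rw [← hab] at hm hc
    set m := (aboveSites l).getD (d.1.toNat - 1) 0 with hmdef
    rw [Finset.mem_filter] at hm
    refine ⟨hm.1, ?_⟩
    have hsp2 := cnt_split A hm.2.le
    rw [cnt, Finset.filter_filter] at hc
    rw [hc] at hsp2
    omega
  · rw [if_neg hd]
    refine ⟨_, rfl, ?_⟩
    have hbe : belowSites l = (A.filter fun a => a ≤ L).sort (· ≤ ·) := rfl
    have hlen : (belowSites l).length = cnt A L := by
      rw [hbe, Finset.length_sort]; rfl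
    rw [hlen]
    obtain ⟨hm, hc⟩ := sort_getD (A.filter fun a => a ≤ L) (cnt A L - 1 - (-d.1).toNat)
      (by show _ < cnt A L; omega)
    rw [← hbe] at hm hc
    set m := (belowSites l).getD (cnt A L - 1 - (-d.1).toNat) 0 with hmdef
    rw [Finset.mem_filter] at hm
    refine ⟨hm.1, ?_⟩
    have e : cnt (A.filter fun a => a ≤ L) m = cnt A m := by
      unfold cnt
      rw [Finset.filter_filter]
      congr 1
      apply Finset.filter_congr
      intro a ha
      have := hm.2
      omega
    rw [e] at hc
    omega

lemma upd_activeSites {l : List ℕ} (hp : IsPermC l) (hb : IsSemiBaxter l) (k : ℕ)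
    (hk : l.length = k + 1) {m : ℕ} (hm : m ∈ activeSites l) :
    Upd (activeSites l) (activeSites (appendVal l m)) m (lastVal l) := by
  have hm' := (mem_activeSites l hb m).1 hm
  have hb' : IsSemiBaxter (appendVal l m) := (isSemiBaxter_appendVal l m).2 ⟨hb, hm'.2⟩
  intro t
  rw [mem_activeSites _ hb', mem_activeSites _ hb, mem_activeSites _ hb, length_appendVal,
    act_append hp k hk hm'.1.1 hm'.2]
  have := hm'.1
  constructor
  · rintro ⟨h0, h | h | h⟩
    · exact Or.inl ⟨h.1, ⟨by omega, h.2⟩⟩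
    · exact Or.inr (Or.inl h)
    · exact Or.inr (Or.inr ⟨h.1, h.2.1, by omega, h.2.2⟩)
  · rintro (h | h | h)
    · exact ⟨by omega, Or.inl ⟨h.1, h.2.2⟩⟩
    · exact ⟨by omega, Or.inr (Or.inl h)⟩
    · exact ⟨by omega, Or.inr (Or.inr ⟨h.1, h.2.1, h.2.2.2⟩)⟩

lemma zWalk_of_le (W : ℕ → ℤ × ℤ) (t k : ℕ) (h : k ≤ t) : zWalk W t k = 0 := by
  cases k with
  | zero => rfl
  | succ k => simp [zWalk, h]

/-- The value of `cpp W n` at `j`. -/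
def cppVal (W : ℕ → ℤ × ℤ) (n j : ℕ) : ℕ :=
  ((Finset.range (j+1)).filter fun i => zWalk W i j ≤ 0).card
      + ((Finset.Icc (j+1) (n-1)).filter fun i => 0 < zWalk W j i).card

/-- The inductive invariant. -/
structure SBInv (W : ℕ → ℤ × ℤ) (k : ℕ) (l : List ℕ) : Prop where
  len : l.length = k + 1
  perm : IsPermC l
  sb : IsSemiBaxter l
  cx : (cnt (activeSites l) (lastVal l) : ℤ) = (W k).1 + 1
  cy : (cnt (activeSites l) (l.length + 1) : ℤ) = (W k).1 + (W k).2 + 2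
  z : ∀ j, j ≤ k → zWalk W j k =
    (cnt (activeSites l) (l.getD j 0) : ℤ) - cnt (activeSites l) (lastVal l)
  val : ∀ j, j ≤ k → l.getD j 0 = cppVal W (k + 1) j

lemma sbinv_zero (W : ℕ → ℤ × ℤ) (h : W 0 = (0, 0)) : SBInv W 0 [1] := by
  have hsb : IsSemiBaxter [1] := by
    rintro ⟨i, j, k, h1, h2, h3, -⟩
    simp at h3
    omega
  have hA : activeSites [1] = {1, 2} := by
    ext t
    rw [mem_activeSites _ hsb]
    have : Act [1] t := by
      intro i j h1 h2
      simp at h2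
    simp only [this, and_true, List.length_singleton, Finset.mem_insert, Finset.mem_singleton]
    omega
  have hL : lastVal [1] = 1 := rfl
  have c1 : cnt {1, 2} 1 = 1 := by
    simp [cnt, Finset.filter_insert, Finset.filter_singleton]
  have c2 : cnt {1, 2} 2 = 2 := by
    simp [cnt, Finset.filter_insert, Finset.filter_singleton]
  refine ⟨rfl, ?_, hsb, ?_, ?_, ?_, ?_⟩
  · intro m h1 h2
    simp only [List.length_singleton] at h2
    have : m = 1 ∨ m = 2 := by omega
    rcases this with rfl | rfl <;> simp [Finset.filter_singleton]
  · rw [hA, hL, c1, h]; simp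
  · rw [hA, List.length_singleton, c2, h]; simp
  · intro j hj
    have : j = 0 := by omega
    subst this
    rw [hL]
    simp [zWalk]
  · intro j hj
    have : j = 0 := by omega
    subst this
    simp [cppVal, zWalk, Finset.filter_singleton]

lemma sbinv_succ (W : ℕ → ℤ × ℤ) (k : ℕ) (l : List ℕ) (h : SBInv W k l)
    (hd : W (k+1) - W k ∈ ISemi) (h1 : 0 ≤ (W (k+1)).1) (h2 : 0 ≤ (W (k+1)).2) :
    SBInv W (k+1) (nextPerm l (W (k+1) - W k)) := by
  have hx : (W (k+1) - W k).1 = (W (k+1)).1 - (W k).1 := rfl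
  have hy : (W (k+1) - W k).2 = (W (k+1)).2 - (W k).2 := rfl
  have hzs : ∀ j, j ≤ k → zWalk W j (k+1) = zStep (zWalk W j k) (W (k+1) - W k) := by
    intro j hj
    show (if _ then _ else _) = _
    rw [if_neg (by omega)]
  set d := W (k+1) - W k with hdd
  have hcase : (d.1 ≤ 0 ∧ d.2 = 1) ∨ (1 ≤ d.1 ∧ d.2 = 1 - d.1) := hd
  have hlen := h.len
  have hcx := h.cx
  have hcy := h.cy
  have hzk := h.z
  have hLk := lastVal_eq l k hlen
  have hLle : lastVal l ≤ l.length := by rw [hLk]; exact h.perm.le (by omega)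
  obtain ⟨m, hm, hmA, hmc⟩ := nextPerm_eq l d
    (fun a ha => ((mem_activeSites l h.sb a).1 ha).1.2) (by omega) (by omega) (by omega)
  have hm' := (mem_activeSites l h.sb m).1 hmA
  have hup := upd_activeSites h.perm h.sb k hlen hmA
  have hL' := lastVal_appendVal l m
  have hlen' : (appendVal l m).length = k + 2 := by rw [length_appendVal, hlen]
  rw [hm]
  set A := activeSites l with hA
  set A' := activeSites (appendVal l m) with hA'
  set L := lastVal l with hLdef
  have hposi : 1 ≤ d.1 → L < m := by
    intro hd1
    by_contra hc
    have := cnt_mono A (by omega : m ≤ L)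
    omega
  have hneg : d.1 ≤ 0 → m ≤ L := by
    intro hd1
    by_contra hc
    have := cnt_lt A (by omega : L < m) hmA
    omega
  have hmm := hup.cnt_le le_rfl
  have hz : ∀ j, j ≤ k → zWalk W j (k+1) = (cnt A' (shiftVal m (l.getD j 0)) : ℤ) - cnt A' m ∧
      (0 < zWalk W j (k+1) ↔ m ≤ l.getD j 0) := by
    intro j hj
    rw [hzs j hj, hzk j hj]
    set v := l.getD j 0 with hv
    rcases shiftVal_cases m v with ⟨hmv, hs⟩ | ⟨hmv, hs⟩
    · rw [hs, hmm]
      have hcv := cnt_mono A hmv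
      simp only [hmv, iff_true]
      rcases Nat.lt_or_ge v L with hvL | hvL
      · have e := hup.cnt_gt_of_le hmv hvL.le
        have f := cnt_mono A hvL.le
        unfold zStep
        split_ifs <;> omega
      · have e := hup.cnt_gt_of_ge hmv hvL
        have f := cnt_mono A hvL
        rcases hcase with hc | hc
        · rw [max_eq_right (hneg hc.1)] at e
          unfold zStep
          split_ifs <;> omega
        · rw [max_eq_left (hposi hc.1).le] at e
          unfold zStep
          split_ifs <;> omega
    · rw [hs, hmm, hup.cnt_le hmv.le]
      have hcv := cnt_lt A hmv hmA
      unfold zStep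
      split_ifs <;> omega
  refine ⟨hlen', h.perm.append hm'.1.1 hm'.1.2, (isSemiBaxter_appendVal l m).2 ⟨h.sb, hm'.2⟩,
    ?_, ?_, ?_, ?_⟩
  · rw [hL', hmm]; omega
  · rw [length_appendVal, ← hA']
    have e := hup.cnt_gt_of_ge hm'.1.2 (by omega)
    rcases hcase with hc | hc
    · rw [max_eq_right (hneg hc.1)] at e
      omega
    · rw [max_eq_left (hposi hc.1).le] at e
      omega
  · intro j hj
    rw [hL']
    rcases Nat.lt_or_ge k j with hjk | hjk
    · have : j = l.length := by omega
      rw [zWalk_of_le W j _ (by omega), this, getD_appendVal_len]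
      omega
    · rw [getD_appendVal_lt _ _ _ (by omega)]
      exact (hz j hjk).1
  · intro j hj
    rcases Nat.lt_or_ge k j with hjk | hjk
    · have hjl : j = k + 1 := by omega
      subst hjl
      have : (appendVal l m).getD (k+1) 0 = m := by rw [← hlen, getD_appendVal_len]
      rw [this]
      unfold cppVal
      have e1 : Finset.Icc (k + 1 + 1) (k + 1 + 1 - 1) = ∅ := by
        apply Finset.Icc_eq_empty; omega
      rw [e1, Finset.filter_empty, Finset.card_empty, add_zero, Finset.range_add_one,
        Finset.filter_insert, if_pos (by rw [zWalk_of_le _ _ _ le_rfl]),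
        Finset.card_insert_of_notMem (by simp)]
      have hp := h.perm m hm'.1.1 hm'.1.2
      rw [hlen] at hp
      rw [← hp]
      congr 2
      apply Finset.filter_congr
      intro i hi
      have := (hz i (by have := Finset.mem_range.1 hi; omega)).2
      omega
    · rw [getD_appendVal_lt _ _ _ (by omega), h.val j hjk]
      have hv := h.val j hjk
      have hzz := (hz j hjk).2
      rw [hv] at hzz
      have e : cppVal W (k+1+1) j = cppVal W (k+1) j + if 0 < zWalk W j (k+1) then 1 else 0 := by
        unfold cppVal
        have e1 : Finset.Icc (j+1) (k+1+1-1) = insert (k+1) (Finset.Icc (j+1) (k+1-1)) := by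
          ext a
          simp only [Finset.mem_insert, Finset.mem_Icc]
          omega
        rw [e1, Finset.filter_insert]
        split_ifs with hpos
        · rw [Finset.card_insert_of_notMem (by simp)]
          omega
        · rfl
      rw [e]
      rcases shiftVal_cases m (cppVal W (k+1) j) with ⟨hmv, hs⟩ | ⟨hmv, hs⟩
      · rw [hs, if_pos (hzz.2 hmv)]
      · rw [hs, if_neg (by rw [hzz]; omega)]; rfl

lemma sbinv_all (n : ℕ) (W : ℕ → ℤ × ℤ) (hW : IsWalkSemi n W) (k : ℕ) (hk : k < n) :
    SBInv W k (pwInv W k) := by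
  induction k with
  | zero => exact sbinv_zero W hW.1
  | succ k ih =>
    exact sbinv_succ W k _ (ih (by omega)) (hW.2.2 k hk) (hW.2.1 _ hk).1 (hW.2.1 _ hk).2

/-- for every `n ≥ 1` and every walk `W ∈ W^n_sb`,
`pw⁻¹(W) = cpp(wcp_sb(W))`; i.e. the diagram commutes on `W^n_sb`. -/
theorem semi_baxter_diagram_commutes (n : ℕ) (hn : 1 ≤ n) (W : ℕ → ℤ × ℤ)
    (hW : IsWalkSemi n W) : pwInv W (n - 1) = cpp W n := by
  have h := sbinv_all n W hW (n - 1) (by omega)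
  have hl := h.len
  apply List.ext_getElem
  · rw [hl]; simp [cpp]; omega
  · intro j h1 h2
    have := h.val j (by omega)
    rw [List.getD_eq_getElem?_getD, List.getElem?_eq_getElem h1, Option.getD_some] at this
    rw [this, show n - 1 + 1 = n by omega]
    simp [cpp, cppVal]
end
end

section
/- Let τ⁺_0 := 0 and τ⁺_{ℓ+1} := inf{i > τ⁺_ℓ : Z̄_{i−1} < 0 and Z̄_i = 1} for the chain (Z̄_k)_{k≥0} associated with semi-Baxter permutations. Then √k · P(τ⁺_1 = k) → 0 as k → ∞, and Σ_{ℓ=0}^{∞} P(τ⁺_ℓ = k) ∼ 1/(β · 2π√k) as k → ∞, where β = (1/√(2π)) · (1/(1−γ)) · (1/σ' + (1+γ)/σ). -/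
attribute [local instance] Classical.propDecidable

noncomputable section

/-- `α = √5 - 2`. -/
def semiα : ℝ := Real.sqrt 5 - 2

/-- `γ = (√5 - 1)/2`. -/
def semiγ : ℝ := (Real.sqrt 5 - 1) / 2

/-- `σ = √(2(2+√5))`. -/
def semiσ : ℝ := Real.sqrt (2 * (2 + Real.sqrt 5))

/-- `σ' = √(1+√5)`. -/
def semiσ' : ℝ := Real.sqrt (1 + Real.sqrt 5)

/-- The constant `β = (1/√(2π)) · (1/(1-γ)) · (1/σ' + (1+γ)/σ)`. -/
def semiβ : ℝ :=
  (1 / Real.sqrt (2 * Real.pi)) * (1 / (1 - semiγ)) * (1 / semiσ' + (1 + semiγ) / semiσ)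

/-- The step distribution `μ_sb`. -/
def wSemi (d : ℤ × ℤ) : ℝ :=
  if d.1 ≤ 0 ∧ d.2 = 1 then semiα * semiγ ^ (-d.1).toNat
  else if 1 ≤ d.1 ∧ d.2 = 1 - d.1 then semiα * semiγ ^ d.1.toNat
  else 0

/-- The chain `Z̄`, driven by the sequence of increments `f` of the walk `W̄`. -/
def zbar (f : ℕ → ℤ × ℤ) : ℕ → ℤ
  | 0 => 0
  | ℓ + 1 => zStep (zbar f ℓ) (f ℓ)

/-- Extension of a finite tuple of increments by a dummy value. -/
def extFin {m : ℕ} (g : Fin m → ℤ × ℤ) : ℕ → ℤ × ℤ :=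
  fun i => if h : i < m then g ⟨i, h⟩ else (0, 0)

/-- Probability of an event depending only on the first `m` i.i.d. increments
(with step distribution `μ_sb`). -/
def probSemi (m : ℕ) (E : (ℕ → ℤ × ℤ) → Prop) : ℝ :=
  ∑' g : Fin m → ℤ × ℤ, if E (extFin g) then ∏ i, wSemi (g i) else 0

/-- `r` is a renewal time: `Z̄_{r-1} < 0` and `Z̄_r = 1`. -/
def isRenewal (f : ℕ → ℤ × ℤ) (r : ℕ) : Prop :=
  zbar f (r - 1) < 0 ∧ zbar f r = 1

/-- The number of renewal times of `Z̄` among the times `1,…,i`. -/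
def renewalCount (f : ℕ → ℤ × ℤ) (i : ℕ) : ℕ :=
  ((Finset.Icc 1 i).filter fun r => isRenewal f r).card

/-- `P(τ⁺_ℓ = k)`, where `τ⁺₀ = 0` and
`τ⁺_{ℓ+1} = inf{i > τ⁺_ℓ : Z̄_{i-1} < 0 ∧ Z̄_i = 1}`: for `ℓ ≥ 1`, `τ⁺_ℓ = k` iff
`k` is a renewal time and there are exactly `ℓ` renewal times among `1,…,k`. -/
def PτSemi (ℓ k : ℕ) : ℝ :=
  probSemi k fun f => if ℓ = 0 then k = 0 else (isRenewal f k ∧ renewalCount f k = ℓ)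


open Filter Topology


/-- coefficients of `(1-s)^(-1/2)` -/
noncomputable def cbN (n : ℕ) : ℝ := ∏ i ∈ Finset.range n, ((2 * i + 1 : ℝ) / (2 * i + 2))

lemma cbN_succ (n : ℕ) : cbN (n + 1) = cbN n * ((2 * n + 1 : ℝ) / (2 * n + 2)) :=
  Finset.prod_range_succ _ _

lemma cbN_nonneg (n : ℕ) : 0 ≤ cbN n := Finset.prod_nonneg fun i _ => by positivity

lemma cbN_le_one (n : ℕ) : cbN n ≤ 1 := by
  refine Finset.prod_le_one (fun i _ => by positivity) fun i _ => ?_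
  rw [div_le_one (by positivity)]; linarith

lemma cbN_sq (n : ℕ) : cbN n ^ 2 * (2 * n + 1) * Real.Wallis.W n = 1 := by
  induction n with
  | zero => simp [cbN, Real.Wallis.W]
  | succ n ih =>
    rw [cbN_succ, Real.Wallis.W_succ]
    have e : ∀ b w : ℝ, (b * ((2 * n + 1 : ℝ) / (2 * n + 2))) ^ 2 * (2 * ((n + 1 : ℕ) : ℝ) + 1) *
        (w * ((2 * n + 2) / (2 * n + 1) * ((2 * n + 2) / (2 * n + 3)))) = b ^ 2 * (2 * n + 1) * w := by
      intro b w
      push_cast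
      field_simp
      ring
    rw [e, ih]

lemma cbN_tendsto : Tendsto (fun n : ℕ => √n * cbN n) atTop (𝓝 (√(1 / Real.pi))) := by
  have h1 : (fun n : ℕ => √n * cbN n) =
      fun n : ℕ => √(((n : ℝ) / (2 * n + 1)) / Real.Wallis.W n) := by
    funext n
    have hW := Real.Wallis.W_pos n
    have : ((n : ℝ) / (2 * n + 1)) / Real.Wallis.W n = n * cbN n ^ 2 := by
      have := cbN_sq n
      field_simp
      linear_combination (-(n : ℝ)) * this
    rw [this, Real.sqrt_mul (by positivity), Real.sqrt_sq (cbN_nonneg n)]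
  rw [h1]
  refine (Real.continuous_sqrt.tendsto _).comp ?_
  have h2 := Stirling.tendsto_self_div_two_mul_self_add_one.div
    Real.Wallis.tendsto_W_nhds_pi_div_two (by positivity)
  have e : (1 / 2 / (Real.pi / 2) : ℝ) = 1 / Real.pi := by field_simp
  rw [e] at h2
  exact h2

lemma cbN_choose (n : ℕ) : Ring.choose ((1/2 : ℝ) + n - 1) n = cbN n := by
  rw [Ring.choose]
  have e : ((1/2 : ℝ) + n - 1 - n + 1) = 1/2 := by ring
  rw [e]
  have h := Ring.factorial_nsmul_multichoose_eq_ascPochhammer (1/2 : ℝ) n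
  rw [← Polynomial.ascPochhammer_smeval_cast ℝ, ← Polynomial.eval_eq_smeval] at h
  have h2 : ∀ n : ℕ, (ascPochhammer ℝ n).eval (1/2) = n.factorial * cbN n := by
    intro n
    induction n with
    | zero => simp [cbN]
    | succ n ih =>
      rw [ascPochhammer_succ_eval, ih, cbN_succ, Nat.factorial_succ]
      push_cast
      field_simp
      ring
  rw [h2, nsmul_eq_mul] at h
  exact mul_left_cancel₀ (by positivity) h

lemma cbN_hasSum {s : ℝ} (h0 : 0 ≤ s) (h1 : s < 1) :
    HasSum (fun n => cbN n * s ^ n) (1 / √(1 - s)) := by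
  have h := (Real.one_div_one_sub_rpow_hasFPowerSeriesOnBall_zero (1/2)).hasSum (y := s)
    (by simp [enorm_eq_nnnorm, ← NNReal.coe_lt_coe, abs_of_nonneg h0, h1])
  simp only [zero_add, ← Real.sqrt_eq_rpow] at h
  have e : (fun n => cbN n * s ^ n) = fun n => (FormalMultilinearSeries.ofScalars ℝ
      (fun n : ℕ => Ring.choose ((1 / 2 : ℝ) + n - 1) n) n) fun _ => s := by
    funext n
    rw [FormalMultilinearSeries.ofScalars_apply_eq, cbN_choose]
    simp
  rw [e]
  exact h

/-- coefficients of `((1-s)(1-ρ s))^(-1/2)` -/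
noncomputable def pN (ρ : ℝ) (n : ℕ) : ℝ :=
  ∑ kl ∈ Finset.HasAntidiagonal.antidiagonal n, cbN kl.1 * (cbN kl.2 * ρ ^ kl.2)

lemma pN_hasSum {ρ s : ℝ} (hρ : 0 ≤ ρ) (hρ1 : ρ < 1) (h0 : 0 ≤ s) (h1 : s < 1) :
    HasSum (fun n => pN ρ n * s ^ n) (1 / √((1 - s) * (1 - ρ * s))) := by
  have a := cbN_hasSum h0 h1
  have hs : ρ * s < 1 := by nlinarith
  have b := cbN_hasSum (s := ρ * s) (by positivity) hs
  have an := a.summable.norm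
  have bn := b.summable.norm
  have t := tsum_mul_tsum_eq_tsum_sum_antidiagonal_of_summable_norm an bn
  have su := (summable_norm_sum_mul_antidiagonal_of_summable_norm an bn).of_norm
  have e : (fun n => pN ρ n * s ^ n) = fun n => ∑ kl ∈ Finset.HasAntidiagonal.antidiagonal n,
      cbN kl.1 * s ^ kl.1 * (cbN kl.2 * (ρ * s) ^ kl.2) := by
    funext n
    rw [pN, Finset.sum_mul]
    refine Finset.sum_congr rfl fun kl hkl => ?_
    rw [← Finset.HasAntidiagonal.mem_antidiagonal.1 hkl, pow_add, mul_pow]; ring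
  rw [e]
  have e2 : 1 / √((1 - s) * (1 - ρ * s)) = 1 / √(1 - s) * (1 / √(1 - ρ * s)) := by
    rw [Real.sqrt_mul (by linarith)]
    field_simp
  rw [e2, ← a.tsum_eq, ← b.tsum_eq, t]
  exact su.hasSum

lemma sqrt_ratio (k m : ℕ) : √((k + m : ℕ) : ℝ) ≤ √(m + 1) * √(k : ℝ) + √m * 1 := by
  have : ((k + m : ℕ) : ℝ) ≤ (√(m + 1) * √(k : ℝ) + √m * 1) ^ 2 := by
    have h1 : √((m : ℝ) + 1) ^ 2 = m + 1 := Real.sq_sqrt (by positivity)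
    have h2 : √(k : ℝ) ^ 2 = k := Real.sq_sqrt (by positivity)
    have h3 : √(m : ℝ) ^ 2 = m := Real.sq_sqrt (by positivity)
    have : 0 ≤ √((m : ℝ) + 1) * √(k : ℝ) * √m := by positivity
    push_cast
    calc (k : ℝ) + m ≤ (m + 1) * k + m := by nlinarith [(by positivity : (0 : ℝ) ≤ m * k)]
      _ = √((m : ℝ) + 1) ^ 2 * √(k : ℝ) ^ 2 + √(m : ℝ) ^ 2 := by rw [h1, h2, h3]
      _ ≤ _ := by nlinarith
  exact (Real.sqrt_le_left (by positivity)).2 this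

lemma pN_tendsto {ρ : ℝ} (hρ : 0 ≤ ρ) (hρ1 : ρ < 1) :
    Tendsto (fun n : ℕ => √n * pN ρ n) atTop (𝓝 (√(1 / Real.pi) * (1 / √(1 - ρ)))) := by
  obtain ⟨M, hM⟩ := cbN_tendsto.bddAbove_range
  have hM' : ∀ n : ℕ, √n * cbN n ≤ M := fun n => hM ⟨n, rfl⟩
  have hM0 : 0 ≤ M := by simpa using hM' 0
  -- shifted limits
  have hshift : ∀ j : ℕ, Tendsto (fun n : ℕ => √n * (if j ≤ n then cbN (n - j) else 0)) atTop
      (𝓝 (√(1 / Real.pi))) := by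
    intro j
    rw [← tendsto_add_atTop_iff_nat j]
    have hr : Tendsto (fun n : ℕ => √(((n + j : ℕ) : ℝ) / n)) atTop (𝓝 1) := by
      have : Tendsto (fun n : ℕ => ((n + j : ℕ) : ℝ) / n) atTop (𝓝 1) := by
        have h2 : Tendsto (fun n : ℕ => 1 + (j : ℝ) / n) atTop (𝓝 (1 + 0)) :=
          tendsto_const_nhds.add (tendsto_const_div_atTop_nhds_zero_nat _)
        rw [add_zero] at h2
        refine h2.congr' ?_
        filter_upwards [eventually_gt_atTop 0] with n hn
        have : (n : ℝ) ≠ 0 := by positivity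
        push_cast; field_simp
      have h3 := (Real.continuous_sqrt.tendsto _).comp this
      rw [Real.sqrt_one] at h3
      exact h3
    have := hr.mul cbN_tendsto
    rw [one_mul] at this
    refine this.congr' ?_
    filter_upwards [eventually_gt_atTop 0] with n hn
    have : 0 < √(n : ℝ) := by positivity
    rw [Real.sqrt_div (by positivity)]
    simp
    field_simp
  have hb := cbN_hasSum hρ hρ1
  have main := tendsto_tsum_of_dominated_convergence (𝓕 := atTop)
    (f := fun (n : ℕ) (j : ℕ) => √n * (if j ≤ n then cbN (n - j) else 0) * (cbN j * ρ ^ j))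
    (g := fun j => √(1 / Real.pi) * (cbN j * ρ ^ j))
    (bound := fun j => ((j + 1) * M + j) * ρ ^ j) ?_ (fun j => (hshift j).mul_const _) ?_
  · rw [tsum_mul_left, hb.tsum_eq] at main
    refine main.congr fun n => ?_
    rw [tsum_eq_sum (s := Finset.range (n + 1)), pN,
      ← Finset.Nat.sum_antidiagonal_swap, Finset.Nat.sum_antidiagonal_eq_sum_range_succ_mk,
      Finset.mul_sum]
    · refine Finset.sum_congr rfl fun j hj => ?_
      have : j ≤ n := by simpa [Nat.lt_succ_iff] using hj
      simp [this]; ring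
    · intro j hj
      have : ¬ j ≤ n := by simpa [Nat.lt_succ_iff] using hj
      simp [this]
  · have s1 := summable_geometric_of_lt_one hρ hρ1
    have s2 : Summable (fun j : ℕ => (j : ℝ) * ρ ^ j) := by
      simpa using summable_pow_mul_geometric_of_norm_lt_one 1 (r := ρ)
        (by rw [Real.norm_eq_abs, abs_of_nonneg hρ]; exact hρ1)
    refine ((s2.mul_left (M + 1)).add (s1.mul_left M)).congr fun j => ?_
    ring
  · refine Eventually.of_forall fun n j => ?_
    have hj1 := cbN_nonneg j
    have hj2 := cbN_le_one j
    have hp : 0 ≤ ρ ^ j := by positivity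
    by_cases hjn : j ≤ n
    · obtain ⟨k, rfl⟩ := Nat.exists_eq_add_of_le' hjn
      have hk1 := cbN_nonneg k
      have hk2 := cbN_le_one k
      simp only [hjn, if_true, Nat.add_sub_cancel]
      have h1 : √((k + j : ℕ) : ℝ) * cbN k ≤ (j + 1) * M + j := by
        have hs1 : √((j : ℝ) + 1) ≤ j + 1 := by
          rw [Real.sqrt_le_left (by positivity)]; nlinarith [(by positivity : (0:ℝ) ≤ j)]
        have hs2 : √(j : ℝ) ≤ j := by
          rw [Real.sqrt_le_left (by positivity)]
          exact_mod_cast Nat.le_self_pow two_ne_zero j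
        calc _ ≤ (√(j + 1) * √(k : ℝ) + √j * 1) * cbN k := by gcongr; exact sqrt_ratio k j
          _ = √(j + 1) * (√(k : ℝ) * cbN k) + √j * cbN k := by ring
          _ ≤ (j + 1) * M + j * 1 := by
            gcongr
            exact hM' k
          _ = _ := by ring
      rw [Real.norm_of_nonneg (by positivity)]
      calc _ ≤ ((j + 1) * M + j) * (1 * ρ ^ j) := by gcongr
        _ = _ := by ring
    · simp [hjn]
      positivity

/-- `A` has generating function `φ` on `(0,1)`. -/
def GFun (A : PowerSeries ℝ) (φ : ℝ → ℝ) : Prop :=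
  ∀ s : ℝ, 0 < s → s < 1 → HasSum (fun n => PowerSeries.coeff n A * s ^ n) (φ s)

lemma GFun.add {A B : PowerSeries ℝ} {φ ψ : ℝ → ℝ} (hA : GFun A φ) (hB : GFun B ψ) :
    GFun (A + B) (fun s => φ s + ψ s) := by
  intro s h0 h1
  simpa [add_mul] using (hA s h0 h1).add (hB s h0 h1)

lemma GFun.smul {A : PowerSeries ℝ} {φ : ℝ → ℝ} (c : ℝ) (hA : GFun A φ) :
    GFun (c • A) (fun s => c * φ s) := by
  intro s h0 h1
  simpa [mul_assoc] using (hA s h0 h1).mul_left c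

lemma GFun.X_mul {A : PowerSeries ℝ} {φ : ℝ → ℝ} (hA : GFun A φ) :
    GFun (PowerSeries.X * A) (fun s => s * φ s) := by
  intro s h0 h1
  rw [← hasSum_nat_add_iff' 1]
  simp only [PowerSeries.coeff_succ_X_mul]
  have := (hA s h0 h1).mul_left s
  simp only [Finset.range_one, Finset.sum_singleton, PowerSeries.coeff_zero_X_mul, zero_mul, sub_zero]
  refine this.congr_fun ?_
  intro n
  ring

lemma GFun.one : GFun 1 (fun _ => 1) := by
  intro s h0 h1
  convert hasSum_single (f := fun n => PowerSeries.coeff n (1 : PowerSeries ℝ) * s ^ n) 0 ?_ using 1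
  · simp
  · intro n hn
    simp [PowerSeries.coeff_one, hn]

lemma gf_zero_aux (c : ℕ → ℝ) (h : ∀ s : ℝ, 0 < s → s < 1 → HasSum (fun n => c n * s ^ n) 0) :
    c 0 = 0 := by
  have hb : Summable fun n => |c n| * (1/2 : ℝ) ^ n := by
    refine (h (1/2) (by norm_num) (by norm_num)).summable.abs.congr fun n => ?_
    rw [abs_mul, abs_of_nonneg (by positivity : (0:ℝ) ≤ (1/2) ^ n)]
  have hmem : ∀ᶠ s : ℝ in 𝓝[>] 0, 0 < s ∧ s < 1/2 :=
    Ioo_mem_nhdsGT (by norm_num : (0:ℝ) < 1/2)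
  have main := tendsto_tsum_of_dominated_convergence (𝓕 := 𝓝[>] (0:ℝ))
    (f := fun (s : ℝ) n => c n * s ^ n) (g := fun n => c n * 0 ^ n)
    (bound := fun n => |c n| * (1/2 : ℝ) ^ n) hb ?_ ?_
  · have e1 : ∑' n, c n * (0:ℝ) ^ n = c 0 := by
      rw [tsum_eq_single 0]
      · simp
      · intro n hn; simp [hn]
    rw [e1] at main
    refine tendsto_nhds_unique main (tendsto_const_nhds.congr' ?_)
    filter_upwards [hmem] with s hs
    exact ((h s hs.1 (by linarith [hs.2])).tsum_eq).symm
  · intro n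
    exact ((by fun_prop : Continuous fun s : ℝ => c n * s ^ n).tendsto 0).mono_left nhdsWithin_le_nhds
  · filter_upwards [hmem] with s hs n
    rw [norm_mul, norm_pow, Real.norm_eq_abs, Real.norm_of_nonneg hs.1.le]
    have := hs.1.le
    have := hs.2.le
    gcongr

lemma gf_zero (n : ℕ) : ∀ (c : ℕ → ℝ) (_ : ∀ s : ℝ, 0 < s → s < 1 → HasSum (fun n => c n * s ^ n) 0),
    c n = 0 := by
  induction n with
  | zero => exact gf_zero_aux
  | succ n ih =>
    intro c h
    refine ih (fun n => c (n + 1)) fun s h0 h1 => ?_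
    have h2 := h s h0 h1
    rw [← hasSum_nat_add_iff' 1] at h2
    simp only [Finset.range_one, Finset.sum_singleton, gf_zero_aux c h, zero_mul, sub_zero] at h2
    have h3 := h2.mul_left s⁻¹
    rw [mul_zero] at h3
    refine h3.congr_fun ?_
    intro n
    rw [pow_succ]
    field_simp

lemma GFun.unique {A B : PowerSeries ℝ} {φ ψ : ℝ → ℝ} (hA : GFun A φ) (hB : GFun B ψ)
    (h : ∀ s : ℝ, 0 < s → s < 1 → φ s = ψ s) : A = B := by
  ext n
  rw [← sub_eq_zero]
  refine gf_zero n (fun n => PowerSeries.coeff n A - PowerSeries.coeff n B) fun s h0 h1 => ?_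
  have := (hA s h0 h1).sub (hB s h0 h1)
  rw [h s h0 h1, sub_self] at this
  simpa [sub_mul] using this

lemma γ_sq : semiγ ^ 2 = 1 - semiγ := by
  have : √(5:ℝ) ^ 2 = 5 := Real.sq_sqrt (by norm_num)
  unfold semiγ
  nlinarith

lemma γ_pos : 0 < semiγ := by
  have : 1 < √(5:ℝ) := by rw [Real.lt_sqrt] <;> norm_num
  unfold semiγ; linarith

lemma γ_lt_one : semiγ < 1 := by
  have : √(5:ℝ) < 3 := by rw [Real.sqrt_lt'] <;> norm_num
  unfold semiγ; linarith

lemma α_eq : semiα = semiγ ^ 3 := by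
  have h : semiα = 2 * semiγ - 1 := by unfold semiα semiγ; ring
  rw [h]
  linear_combination (1 - semiγ) * γ_sq

lemma wSemi_nonneg (d : ℤ × ℤ) : 0 ≤ wSemi d := by
  have := γ_pos
  unfold wSemi
  rw [α_eq]
  split_ifs <;> positivity

lemma wSemi_left (i : ℕ) : wSemi (-(i : ℤ), 1) = semiγ ^ 3 * semiγ ^ i := by
  simp [wSemi, α_eq]

lemma wSemi_right (i : ℕ) : wSemi ((i : ℤ) + 1, -(i : ℤ)) = semiγ ^ 3 * semiγ ^ (i + 1) := by
  have h1 : ¬ ((i : ℤ) + 1 ≤ 0) := by lia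
  have h2 : ((i : ℤ) + 1).toNat = i + 1 := by lia
  simp [wSemi, α_eq, h1, h2]

/-- enumeration of the support of the step distribution -/
def stepEnum : ℕ ⊕ ℕ → ℤ × ℤ
  | .inl i => (-(i : ℤ), 1)
  | .inr i => ((i : ℤ) + 1, -(i : ℤ))

lemma stepEnum_inj : Function.Injective stepEnum := by
  rintro (i | i) (j | j) h <;> simp [stepEnum] at h ⊢ <;> lia

lemma hasSum_w {φ : ℤ × ℤ → ℝ} {a b : ℝ}
    (h1 : HasSum (fun i : ℕ => semiγ ^ 3 * semiγ ^ i * φ (-(i : ℤ), 1)) a)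
    (h2 : HasSum (fun i : ℕ => semiγ ^ 3 * semiγ ^ (i + 1) * φ ((i : ℤ) + 1, -(i : ℤ))) b) :
    HasSum (fun d => wSemi d * φ d) (a + b) := by
  rw [← stepEnum_inj.hasSum_iff]
  · refine HasSum.sum ?_ ?_
    · simpa [Function.comp_def, stepEnum, wSemi_left] using h1
    · simpa [Function.comp_def, stepEnum, wSemi_right] using h2
  · rintro ⟨x, y⟩ h
    have : wSemi (x, y) = 0 := by
      unfold wSemi
      rw [if_neg, if_neg]
      · rintro ⟨h1, h2⟩
        apply h
        refine ⟨.inr (x - 1).toNat, ?_⟩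
        simp only [stepEnum, Prod.mk.injEq] at *
        lia
      · rintro ⟨h1, h2⟩
        apply h
        refine ⟨.inl (-x).toNat, ?_⟩
        simp only [stepEnum, Prod.mk.injEq] at *
        lia
    rw [this, zero_mul]

lemma hasSum_geo_aux {c q : ℝ} (h0 : 0 ≤ q) (h1 : q < 1) :
    HasSum (fun i : ℕ => c * q ^ i) (c / (1 - q)) := by
  simpa [div_eq_mul_inv] using (hasSum_geometric_of_lt_one h0 h1).mul_left c

lemma γ_ne : (1 - semiγ) ≠ 0 := by linarith [γ_lt_one]

lemma hasSum_wSemi : HasSum wSemi 1 := by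
  have h1 := hasSum_geo_aux (c := semiγ ^ 3) γ_pos.le γ_lt_one
  have h2 := hasSum_geo_aux (c := semiγ ^ 4) γ_pos.le γ_lt_one
  have h := hasSum_w (φ := fun _ => 1) (by simpa using h1) (by
    refine h2.congr_fun ?_
    intro n; ring)
  have e : semiγ ^ 3 / (1 - semiγ) + semiγ ^ 4 / (1 - semiγ) = 1 := by
    have := γ_ne
    field_simp
    have := γ_sq
    linear_combination (semiγ ^ 2 + 1) * this
  rw [e] at h
  simpa using h

lemma summable_w_mul {φ : ℤ × ℤ → ℝ} {M : ℝ} (h : ∀ d, |φ d| ≤ M) :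
    Summable (fun d => wSemi d * φ d) := by
  refine Summable.of_norm_bounded (hasSum_wSemi.summable.mul_right M) fun d => ?_
  rw [norm_mul, Real.norm_of_nonneg (wSemi_nonneg d)]
  exact mul_le_mul_of_nonneg_left (h d) (wSemi_nonneg d)

lemma tsum_w_mul_le {φ : ℤ × ℤ → ℝ} {M : ℝ} (h : ∀ d, |φ d| ≤ M) :
    |∑' d, wSemi d * φ d| ≤ M := by
  have h1 := tsum_of_norm_bounded (f := fun d => wSemi d * φ d) (hasSum_wSemi.mul_right M) fun d => by
    rw [norm_mul, Real.norm_of_nonneg (wSemi_nonneg d)]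
    exact mul_le_mul_of_nonneg_left (h d) (wSemi_nonneg d)
  simpa using h1

/-- the reset event at a step -/
def isReset (z : ℤ) (d : ℤ × ℤ) : Prop := z < 0 ∧ zStep z d = 1

/-- backward recursion for (first if `θ = 0`, any if `θ = 1`) renewal probabilities -/
def aSeq (θ : ℝ) : ℕ → ℤ → ℝ
  | 0, _ => 0
  | 1, z => ∑' d, wSemi d * (if isReset z d then 1 else 0)
  | k + 2, z => ∑' d, wSemi d * ((if isReset z d then θ else 1) * aSeq θ (k + 1) (zStep z d))

lemma aSeq_bound {θ : ℝ} (h0 : 0 ≤ θ) (h1 : θ ≤ 1) (k : ℕ) : ∀ z, |aSeq θ k z| ≤ 1 := by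
  induction k using Nat.strong_induction_on with
  | _ k ih =>
  intro z
  match k with
  | 0 => simp [aSeq]
  | 1 =>
    refine tsum_w_mul_le fun d => ?_
    split_ifs <;> simp
  | k + 2 =>
    refine tsum_w_mul_le fun d => ?_
    rw [abs_mul]
    have := ih (k + 1) (by lia) (zStep z d)
    refine mul_le_one₀ ?_ (abs_nonneg _) this
    split_ifs
    · rwa [abs_of_nonneg h0]
    · simp

lemma aSeq_nonneg {θ : ℝ} (h0 : 0 ≤ θ) (k : ℕ) : ∀ z, 0 ≤ aSeq θ k z := by
  induction k using Nat.strong_induction_on with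
  | _ k ih =>
  intro z
  match k with
  | 0 => simp [aSeq]
  | 1 =>
    refine tsum_nonneg fun d => mul_nonneg (wSemi_nonneg d) ?_
    split_ifs <;> simp
  | k + 2 =>
    refine tsum_nonneg fun d => mul_nonneg (wSemi_nonneg d) (mul_nonneg ?_ (ih (k + 1) (by lia) _))
    split_ifs <;> simp [h0]

/-- the integrand of the one step equation -/
def tKer (θ : ℝ) (v : ℤ → ℝ) (z : ℤ) (d : ℤ × ℤ) : ℝ :=
  (if isReset z d then 1 else 0) + (if isReset z d then θ else 1) * v (zStep z d)

/-- truncated generating function -/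
def aPart (θ s : ℝ) (N : ℕ) (z : ℤ) : ℝ := ∑ k ∈ Finset.range (N + 1), aSeq θ k z * s ^ k

lemma aPart_succ {θ s : ℝ} (h0 : 0 ≤ θ) (h1 : θ ≤ 1) (N : ℕ) (z : ℤ) :
    aPart θ s (N + 1) z = s * ∑' d, wSemi d * tKer θ (aPart θ s N) z d := by
  have hfac : ∀ d, |(if isReset z d then θ else 1 : ℝ)| ≤ 1 := by
    intro d; split_ifs
    · rwa [abs_of_nonneg h0]
    · simp
  have hS : ∀ k, Summable fun d => wSemi d *
      ((if isReset z d then θ else 1) * aSeq θ (k + 1) (zStep z d)) := by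
    intro k
    refine summable_w_mul (M := 1) fun d => ?_
    rw [abs_mul]
    exact mul_le_one₀ (hfac d) (abs_nonneg _) (aSeq_bound h0 h1 _ _)
  have hS0 : Summable fun d => wSemi d * (if isReset z d then (1:ℝ) else 0) := by
    refine summable_w_mul (M := 1) fun d => ?_
    split_ifs <;> simp
  have e1 : (fun d => wSemi d * tKer θ (aPart θ s N) z d) = fun d =>
      wSemi d * (if isReset z d then (1:ℝ) else 0) + ∑ k ∈ Finset.range N,
        wSemi d * ((if isReset z d then θ else 1) * aSeq θ (k + 1) (zStep z d)) * s ^ (k + 1) := by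
    funext d
    rw [tKer, aPart, Finset.sum_range_succ', mul_add]
    congr 1
    simp only [aSeq, zero_mul, add_zero]
    rw [Finset.mul_sum, Finset.mul_sum]
    exact Finset.sum_congr rfl fun k _ => by ring
  rw [e1, hS0.tsum_add (summable_sum fun k _ => (hS k).mul_right _),
    Summable.tsum_finsetSum fun k _ => (hS k).mul_right _]
  rw [aPart, Finset.sum_range_succ', Finset.sum_range_succ', mul_add, Finset.mul_sum]
  simp only [aSeq, tsum_mul_right]
  rw [add_comm]
  simp only [zero_mul, zero_add, pow_one]
  rw [add_comm]
  congr 1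
  · rw [mul_comm]
  · exact Finset.sum_congr rfl fun k _ => by ring

lemma gf_of_fixed {θ s M : ℝ} (h0 : 0 ≤ θ) (h1 : θ ≤ 1) (hs0 : 0 < s) (hs1 : s < 1) {W : ℤ → ℝ}
    (hM : ∀ z, |W z| ≤ M)
    (hW : ∀ z, HasSum (fun d => wSemi d * tKer θ W z d) (W z / s)) (z : ℤ) :
    HasSum (fun k => aSeq θ k z * s ^ k) (W z) := by
  have hfac : ∀ z d, |(if isReset z d then θ else 1 : ℝ)| ≤ 1 := by
    intro z d; split_ifs
    · rwa [abs_of_nonneg h0]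
    · simp
  have hK : ∀ (v : ℤ → ℝ) (L : ℝ), (∀ z, |v z| ≤ L) → ∀ z d, |tKer θ v z d| ≤ 1 + L := by
    intro v L hL z d
    refine (abs_add_le _ _).trans (add_le_add ?_ ?_)
    · split_ifs <;> simp
    · rw [abs_mul]
      calc _ ≤ 1 * |v (zStep z d)| := by gcongr; exact hfac z d
        _ ≤ L := by simpa using hL _
  have hb : ∀ N z, |aPart θ s N z| ≤ (N + 1 : ℕ) := by
    intro N z
    rw [aPart]
    refine (Finset.abs_sum_le_sum_abs _ _).trans ?_
    have : ∀ k ∈ Finset.range (N + 1), |aSeq θ k z * s ^ k| ≤ 1 := by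
      intro k _
      rw [abs_mul]
      refine mul_le_one₀ (aSeq_bound h0 h1 _ _) (abs_nonneg _) ?_
      rw [abs_of_nonneg (by positivity)]
      exact pow_le_one₀ hs0.le hs1.le
    simpa using Finset.sum_le_sum this
  have key : ∀ N z, |aPart θ s N z - W z| ≤ M * s ^ N := by
    intro N
    induction N with
    | zero => intro z; simpa [aPart, aSeq] using hM z
    | succ N ih =>
      intro z
      have e : aPart θ s (N + 1) z - W z = s * ∑' d, wSemi d *
          (tKer θ (aPart θ s N) z d - tKer θ W z d) := by
        simp only [mul_sub]
        rw [Summable.tsum_sub (summable_w_mul (hK _ _ (hb N) z)) (hW z).summable, (hW z).tsum_eq,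
          aPart_succ h0 h1]
        field_simp
      rw [e, abs_mul, abs_of_pos hs0]
      have : |∑' d, wSemi d * (tKer θ (aPart θ s N) z d - tKer θ W z d)| ≤ M * s ^ N := by
        refine tsum_w_mul_le fun d => ?_
        have : tKer θ (aPart θ s N) z d - tKer θ W z d =
          (if isReset z d then θ else 1) * (aPart θ s N (zStep z d) - W (zStep z d)) := by
          unfold tKer; ring
        rw [this, abs_mul]
        calc _ ≤ 1 * |(aPart θ s N (zStep z d) - W (zStep z d))| := by gcongr; exact hfac z d
          _ ≤ _ := by simpa using ih _
      calc _ ≤ s * (M * s ^ N) := by gcongr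
        _ = _ := by ring
  rw [hasSum_iff_tendsto_nat_of_nonneg (fun k => mul_nonneg (aSeq_nonneg h0 k z) (by positivity)),
    ← tendsto_add_atTop_iff_nat 1, tendsto_iff_norm_sub_tendsto_zero]
  refine squeeze_zero (fun _ => norm_nonneg _) (fun N => key N z) ?_
  simpa using (tendsto_pow_atTop_nhds_zero_of_lt_one hs0.le hs1).const_mul M
/-- generating function (at `s`) of the first renewal time, started from `z` -/
def Vf (s F : ℝ) (z : ℤ) : ℝ :=
  if 1 ≤ z then (semiγ + semiγ ^ 2 * F) ^ (z - 1).toNat * F ^ 2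
  else if z = 0 then s * (semiγ * F ^ 2 + semiγ ^ 2 * F)
  else ((F + semiγ) / (1 + semiγ * F)) ^ (-z - 1).toNat * (F * (1 + semiγ) / (1 + semiγ * F))

lemma Vf_pos (s F : ℝ) (n : ℕ) :
    Vf s F ((n : ℤ) + 1) = (semiγ + semiγ ^ 2 * F) ^ n * F ^ 2 := by
  have : (1 : ℤ) ≤ (n : ℤ) + 1 := by lia
  simp [Vf, this]

lemma Vf_neg (s F : ℝ) (n : ℕ) :
    Vf s F (-((n : ℤ) + 1)) =
      ((F + semiγ) / (1 + semiγ * F)) ^ n * (F * (1 + semiγ) / (1 + semiγ * F)) := by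
  have h1 : ¬ (1 : ℤ) ≤ -((n : ℤ) + 1) := by lia
  have h2 : ¬ (-((n : ℤ) + 1) = 0) := by lia
  have h3 : (- -((n : ℤ) + 1) - 1).toNat = n := by lia
  simp only [Vf, h1, h2, h3, if_false]

lemma Vf_zero (s F : ℝ) : Vf s F 0 = s * (semiγ * F ^ 2 + semiγ ^ 2 * F) := by simp [Vf]

/-- one-step functional with killing value `1` -/
def psiV (s F : ℝ) (z : ℤ) (d : ℤ × ℤ) : ℝ := if isReset z d then 1 else Vf s F (zStep z d)

lemma psiV_of {s F : ℝ} {z z' : ℤ} {d : ℤ × ℤ} (h : zStep z d = z') (hz : 0 ≤ z ∨ z' ≠ 1) :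
    psiV s F z d = Vf s F z' := by
  rw [psiV, if_neg, h]
  rintro ⟨h1, h2⟩
  rcases hz with hz | hz
  · lia
  · exact hz (h ▸ h2)

section fixed
variable {s F : ℝ}

lemma y_facts (hF0 : 0 < F) (hF1 : F < 1) : 0 ≤ (F + semiγ) / (1 + semiγ * F) ∧
    (F + semiγ) / (1 + semiγ * F) ≤ 1 := by
  have h0 := γ_pos
  have h1 := γ_lt_one
  refine ⟨by positivity, ?_⟩
  rw [div_le_one (by positivity)]
  nlinarith

lemma hasSum_y (hF0 : 0 < F) (hF1 : F < 1) : HasSum (fun m : ℕ => semiγ ^ m *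
    (((F + semiγ) / (1 + semiγ * F)) ^ m * (F * (1 + semiγ) / (1 + semiγ * F)))) (F / semiγ ^ 2) := by
  have h0 := γ_pos
  have h1 := γ_lt_one
  obtain ⟨hy0, hy1⟩ := y_facts hF0 hF1
  have h := hasSum_geo_aux (c := F * (1 + semiγ) / (1 + semiγ * F))
    (q := semiγ * ((F + semiγ) / (1 + semiγ * F))) (by positivity) (by nlinarith)
  have e : F * (1 + semiγ) / (1 + semiγ * F) / (1 - semiγ * ((F + semiγ) / (1 + semiγ * F)))
      = F / semiγ ^ 2 := by
    have e2 : 1 - semiγ * ((F + semiγ) / (1 + semiγ * F)) = semiγ / (1 + semiγ * F) := by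
      field_simp
      linear_combination -γ_sq
    rw [e2]
    field_simp
    linear_combination γ_sq
  rw [e] at h
  refine h.congr_fun ?_
  intro m
  rw [mul_pow]; ring

lemma fixed_zero (hs : 0 < s) (hF0 : 0 < F) (hF1 : F < 1) :
    HasSum (fun d => wSemi d * psiV s F 0 d) (Vf s F 0 / s) := by
  have h0 := γ_pos
  have e : Vf s F 0 / s = semiγ ^ 3 * F ^ 2 / (1 - semiγ) + semiγ ^ 4 * (F / semiγ ^ 2) := by
    rw [Vf_zero, ← γ_sq]
    field_simp
  rw [e]
  refine hasSum_w ?_ ?_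
  · refine (hasSum_geo_aux γ_pos.le γ_lt_one).congr_fun ?_
    intro i
    rw [psiV_of (z' := ((0 : ℕ) : ℤ) + 1) (by simp [zStep]) (by simp), Vf_pos]
    ring
  · refine ((hasSum_y hF0 hF1).mul_left (semiγ ^ 4)).congr_fun ?_
    intro i
    rw [psiV_of (z' := -((i : ℤ) + 1)) (by simp [zStep]) (by simp), Vf_neg]
    ring

lemma fixed_pos (hs : 0 < s) (hF0 : 0 < F) (hF1 : F < 1)
    (key : F = s * semiγ ^ 2 * (F + semiγ) * (1 + semiγ * F)) (n : ℕ) :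
    HasSum (fun d => wSemi d * psiV s F ((n : ℤ) + 1) d) (Vf s F ((n : ℤ) + 1) / s) := by
  have h0 := γ_pos
  set x := semiγ + semiγ ^ 2 * F with hx
  have e : Vf s F ((n : ℤ) + 1) / s = semiγ ^ 3 * x ^ (n + 1) * F ^ 2 / (1 - semiγ) +
      (semiγ ^ (n + 5) * (F / semiγ ^ 2) +
        ∑ i ∈ Finset.range (n + 1), semiγ ^ 3 * semiγ ^ (i + 1) * (x ^ (n - i) * F ^ 2)) := by
    have g := (Commute.all semiγ x).geom_sum₂_mul (n + 1)
    have e1 : ∑ i ∈ Finset.range (n + 1), semiγ ^ 3 * semiγ ^ (i + 1) * (x ^ (n - i) * F ^ 2) =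
        semiγ ^ 4 * F ^ 2 * ∑ i ∈ Finset.range (n + 1), semiγ ^ i * x ^ (n + 1 - 1 - i) := by
      rw [Finset.mul_sum]
      refine Finset.sum_congr rfl fun i _ => ?_
      simp only [Nat.add_sub_cancel]
      ring
    rw [e1, Vf_pos, ← hx, ← γ_sq]
    generalize (∑ i ∈ Finset.range (n + 1), semiγ ^ i * x ^ (n + 1 - 1 - i)) = S at g
    have g' : semiγ ^ 2 * F * S = x ^ (n + 1) - semiγ ^ (n + 1) := by
      rw [hx] at g ⊢
      linear_combination -g
    have e2 : semiγ ^ 4 * F ^ 2 * S = semiγ ^ 2 * F * (x ^ (n + 1) - semiγ ^ (n + 1)) := by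
      rw [← g']; ring
    rw [e2, div_eq_iff hs.ne']
    have e3 : semiγ ^ (n + 5) * (F / semiγ ^ 2) = semiγ ^ 2 * F * semiγ ^ (n + 1) := by
      field_simp
      ring
    have e4 : semiγ ^ 3 * x ^ (n + 1) * F ^ 2 / semiγ ^ 2 = semiγ * x ^ (n + 1) * F ^ 2 := by
      field_simp
    rw [e3, e4]
    have k2 : F = s * semiγ * x * (F + semiγ) := by rw [hx]; linear_combination key
    rw [pow_succ]
    linear_combination x ^ n * F * k2
  rw [e]
  refine hasSum_w ?_ ?_
  · have := hasSum_geo_aux (c := semiγ ^ 3 * x ^ (n + 1) * F ^ 2) γ_pos.le γ_lt_one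
    refine this.congr_fun ?_
    intro i
    rw [psiV_of (z' := ((n + 1 : ℕ) : ℤ) + 1) (by simp [zStep]; lia) (Or.inl (by lia)), Vf_pos]
    ring
  · have h := ((hasSum_y hF0 hF1).mul_left (semiγ ^ (n + 5)))
    have e1 : ∑ i ∈ Finset.range (n + 1), semiγ ^ 3 * semiγ ^ (i + 1) * (x ^ (n - i) * F ^ 2) =
        ∑ i ∈ Finset.range (n + 1), semiγ ^ 3 * semiγ ^ (i + 1) *
          psiV s F ((n : ℤ) + 1) ((i : ℤ) + 1, -(i : ℤ)) := by
      refine Finset.sum_congr rfl fun i hi => ?_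
      have hi' : i ≤ n := by simpa [Nat.lt_succ_iff] using hi
      rw [psiV_of (z' := ((n - i : ℕ) : ℤ) + 1) (by simp [zStep]; lia) (Or.inl (by lia)), Vf_pos]
    rw [e1, ← hasSum_nat_add_iff (n + 1)]
    refine h.congr_fun ?_
    intro m
    rw [psiV_of (z' := -((m : ℤ) + 1)) (by simp [zStep]; lia) (Or.inl (by lia)), Vf_neg]
    ring

lemma fixed_neg (hs : 0 < s) (hF0 : 0 < F) (hF1 : F < 1)
    (key : F = s * semiγ ^ 2 * (F + semiγ) * (1 + semiγ * F)) (n : ℕ) :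
    HasSum (fun d => wSemi d * psiV s F (-((n : ℤ) + 1)) d) (Vf s F (-((n : ℤ) + 1)) / s) := by
  have h0 := γ_pos
  set y := (F + semiγ) / (1 + semiγ * F) with hy
  set E := F * (1 + semiγ) / (1 + semiγ * F) with hE
  have e : Vf s F (-((n : ℤ) + 1)) / s = (semiγ ^ (n + 4) / (1 - semiγ) +
      ∑ i ∈ Finset.range (n + 1), semiγ ^ 3 * semiγ ^ i * (y ^ (n - i) * E)) +
      semiγ ^ 4 * y ^ (n + 1) * (F / semiγ ^ 2) := by
    have g := (Commute.all semiγ y).geom_sum₂_mul (n + 1)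
    have e1 : ∑ i ∈ Finset.range (n + 1), semiγ ^ 3 * semiγ ^ i * (y ^ (n - i) * E) =
        semiγ ^ 3 * E * ∑ i ∈ Finset.range (n + 1), semiγ ^ i * y ^ (n + 1 - 1 - i) := by
      rw [Finset.mul_sum]
      refine Finset.sum_congr rfl fun i _ => ?_
      simp only [Nat.add_sub_cancel]
      ring
    rw [e1, Vf_neg, ← hy, ← hE, ← γ_sq]
    generalize (∑ i ∈ Finset.range (n + 1), semiγ ^ i * y ^ (n + 1 - 1 - i)) = S at g
    have yE : y - semiγ = semiγ ^ 2 * E := by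
      rw [hy, hE]
      field_simp
      linear_combination (-F - semiγ * F) * γ_sq
    have e2 : semiγ ^ 3 * E * S = semiγ * (y ^ (n + 1) - semiγ ^ (n + 1)) := by
      linear_combination -semiγ * g - semiγ * S * yE
    rw [e2, div_eq_iff hs.ne']
    have e3 : semiγ ^ (n + 4) / semiγ ^ 2 = semiγ * semiγ ^ (n + 1) := by
      field_simp
      ring
    have e4 : semiγ ^ 4 * y ^ (n + 1) * (F / semiγ ^ 2) = semiγ ^ 2 * y ^ (n + 1) * F := by
      field_simp
    rw [e3, e4]
    have k2 : E = s * y * (semiγ + semiγ ^ 2 * F) := by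
      rw [hy, hE]
      field_simp
      have : semiγ * (F * (1 + semiγ)) = semiγ * (s * semiγ * (F + semiγ) * (1 + semiγ * F)) := by
        linear_combination key + F * γ_sq
      have := mul_left_cancel₀ h0.ne' this
      linear_combination this
    rw [pow_succ]
    linear_combination y ^ n * k2
  rw [e]
  refine hasSum_w ?_ ?_
  · have h := hasSum_geo_aux (c := semiγ ^ (n + 4)) γ_pos.le γ_lt_one
    have e1 : ∑ i ∈ Finset.range (n + 1), semiγ ^ 3 * semiγ ^ i * (y ^ (n - i) * E) =
        ∑ i ∈ Finset.range (n + 1), semiγ ^ 3 * semiγ ^ i *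
          psiV s F (-((n : ℤ) + 1)) (-(i : ℤ), 1) := by
      refine Finset.sum_congr rfl fun i hi => ?_
      have hi' : i ≤ n := by simpa [Nat.lt_succ_iff] using hi
      rw [psiV_of (z' := -(((n - i : ℕ) : ℤ) + 1)) (by simp only [zStep]; split_ifs <;> lia)
        (Or.inr (by lia)), Vf_neg]
    rw [e1, ← hasSum_nat_add_iff (n + 1)]
    refine h.congr_fun ?_
    intro m
    have : isReset (-((n : ℤ) + 1)) (-((m + (n + 1) : ℕ) : ℤ), 1) :=
      ⟨by lia, by simp only [zStep]; split_ifs <;> lia⟩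
    rw [psiV, if_pos this]
    ring
  · have h := ((hasSum_y hF0 hF1).mul_left (semiγ ^ 4 * y ^ (n + 1)))
    refine h.congr_fun ?_
    intro m
    rw [psiV_of (z' := -(((n + m + 1 : ℕ) : ℤ) + 1)) (by simp only [zStep]; split_ifs <;> lia)
        (Or.inr (by lia)), Vf_neg]
    ring

lemma fixed_all (hs : 0 < s) (hF0 : 0 < F) (hF1 : F < 1)
    (key : F = s * semiγ ^ 2 * (F + semiγ) * (1 + semiγ * F)) (z : ℤ) :
    HasSum (fun d => wSemi d * psiV s F z d) (Vf s F z / s) := by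
  rcases lt_trichotomy z 0 with h | h | h
  · obtain ⟨n, rfl⟩ : ∃ n : ℕ, z = -((n : ℤ) + 1) := ⟨(-z - 1).toNat, by lia⟩
    exact fixed_neg hs hF0 hF1 key n
  · subst h; exact fixed_zero hs hF0 hF1
  · obtain ⟨n, rfl⟩ : ∃ n : ℕ, z = (n : ℤ) + 1 := ⟨(z - 1).toNat, by lia⟩
    exact fixed_pos hs hF0 hF1 key n

lemma Vf_bound (hs : 0 < s) (hs1 : s < 1) (hF0 : 0 < F) (hF1 : F < 1) (z : ℤ) : |Vf s F z| ≤ 2 := by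
  have h0 := γ_pos
  have h1 := γ_lt_one
  obtain ⟨hy0, hy1⟩ := y_facts hF0 hF1
  have hF2 : F ^ 2 ≤ 1 := pow_le_one₀ hF0.le hF1.le
  rcases lt_trichotomy z 0 with h | h | h
  · obtain ⟨n, rfl⟩ : ∃ n : ℕ, z = -((n : ℤ) + 1) := ⟨(-z - 1).toNat, by lia⟩
    rw [Vf_neg, abs_of_nonneg (by positivity)]
    have : F * (1 + semiγ) / (1 + semiγ * F) ≤ 1 := by
      rw [div_le_one (by positivity)]; nlinarith
    calc _ ≤ (1:ℝ) * 1 := by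
          gcongr
          exact pow_le_one₀ hy0 hy1
      _ ≤ 2 := by norm_num
  · subst h; rw [Vf_zero, abs_of_nonneg (by positivity)]
    calc _ ≤ (1 : ℝ) * (1 * 1 + 1 * 1) := by
          gcongr
          exact pow_le_one₀ h0.le h1.le
      _ = 2 := by norm_num
  · obtain ⟨n, rfl⟩ : ∃ n : ℕ, z = (n : ℤ) + 1 := ⟨(z - 1).toNat, by lia⟩
    rw [Vf_pos, abs_of_nonneg (by positivity)]
    calc _ ≤ (1:ℝ) * 1 := by
          gcongr
          exact pow_le_one₀ (by positivity) (by nlinarith [γ_sq, sq_nonneg semiγ])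
      _ ≤ 2 := by norm_num

lemma aSeq_gf {θ C : ℝ} (h0 : 0 ≤ θ) (h1 : θ ≤ 1) (hs : 0 < s) (hs1 : s < 1) (hF0 : 0 < F)
    (hF1 : F < 1) (key : F = s * semiγ ^ 2 * (F + semiγ) * (1 + semiγ * F))
    (hC : C = 1 + θ * (C * F ^ 2)) (z : ℤ) :
    HasSum (fun k => aSeq θ k z * s ^ k) (C * Vf s F z) := by
  refine gf_of_fixed h0 h1 hs hs1 (W := fun z => C * Vf s F z) (M := |C| * 2) ?_ ?_ z
  · intro z
    rw [abs_mul]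
    exact mul_le_mul_of_nonneg_left (Vf_bound hs hs1 hF0 hF1 z) (abs_nonneg _)
  · intro z
    have h := (fixed_all hs hF0 hF1 key z).mul_left C
    rw [← mul_div_assoc] at h
    refine h.congr_fun ?_
    intro d
    unfold tKer psiV
    by_cases hr : isReset z d
    · simp only [hr, if_true]
      have e : Vf s F (zStep z d) = F ^ 2 := by
        rw [hr.2]
        simpa using Vf_pos s F 0
      rw [e, ← hC]; ring
    · simp only [hr, if_false]; ring

end fixed
/-- prepend an increment to a sequence of increments -/
def ncons (d : ℤ × ℤ) (f : ℕ → ℤ × ℤ) : ℕ → ℤ × ℤ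
  | 0 => d
  | n + 1 => f n

lemma extFin_cons {m : ℕ} (d : ℤ × ℤ) (g : Fin m → ℤ × ℤ) :
    extFin (Fin.cons d g : Fin (m + 1) → ℤ × ℤ) = ncons d (extFin g) := by
  funext i
  cases i with
  | zero => simp [extFin, ncons]
  | succ i =>
    simp only [extFin, ncons]
    by_cases h : i < m
    · have h' : i + 1 < m + 1 := by lia
      simp only [h, h', dif_pos]
      exact Fin.cons_succ (α := fun _ => ℤ × ℤ) d g ⟨i, h⟩
    · have h' : ¬ i + 1 < m + 1 := by lia
      simp only [h, h', dif_neg, not_false_iff]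

/-- the equivalence of tuples with head and tail -/
def consE (m : ℕ) : (ℤ × ℤ) × (Fin m → ℤ × ℤ) ≃ (Fin (m + 1) → ℤ × ℤ) :=
  Fin.consEquiv (fun _ => ℤ × ℤ)

lemma consE_apply (m : ℕ) (p : (ℤ × ℤ) × (Fin m → ℤ × ℤ)) :
    consE m p = Fin.cons p.1 p.2 := rfl

lemma prodW_nonneg {m : ℕ} (g : Fin m → ℤ × ℤ) : 0 ≤ ∏ i, wSemi (g i) :=
  Finset.prod_nonneg fun _ _ => wSemi_nonneg _

lemma hasSum_prodW (m : ℕ) : HasSum (fun g : Fin m → ℤ × ℤ => ∏ i, wSemi (g i)) 1 := by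
  induction m with
  | zero => simp
  | succ m ih =>
    rw [← (consE m).hasSum_iff]
    have hs : Summable fun x : (ℤ × ℤ) × (Fin m → ℤ × ℤ) => wSemi x.1 * ∏ i, wSemi (x.2 i) :=
      Summable.mul_of_nonneg (f := wSemi) (g := fun g : Fin m → ℤ × ℤ => ∏ i, wSemi (g i))
        hasSum_wSemi.summable ih.summable (fun d => wSemi_nonneg d) (fun g => prodW_nonneg g)
    have h := hasSum_wSemi.mul ih hs
    rw [one_mul] at h
    refine h.congr_fun ?_
    rintro ⟨d, g⟩
    simp [consE_apply, Fin.prod_univ_succ]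

lemma summable_prob (m : ℕ) (E : (ℕ → ℤ × ℤ) → Prop) :
    Summable (fun g : Fin m → ℤ × ℤ => if E (extFin g) then ∏ i, wSemi (g i) else 0) := by
  refine Summable.of_nonneg_of_le (fun g => ?_) (fun g => ?_) (hasSum_prodW m).summable
  · split_ifs
    · exact prodW_nonneg g
    · exact le_rfl
  · split_ifs
    · exact le_rfl
    · exact prodW_nonneg g

lemma probSemi_succ (m : ℕ) (E : (ℕ → ℤ × ℤ) → Prop) :
    probSemi (m + 1) E = ∑' d, wSemi d * probSemi m (fun f => E (ncons d f)) := by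
  unfold probSemi
  rw [← (consE m).tsum_eq]
  have hs := (consE m).summable_iff.2 (summable_prob (m + 1) E)
  rw [Summable.tsum_prod (by exact hs)]
  refine tsum_congr fun d => ?_
  rw [← tsum_mul_left]
  refine tsum_congr fun g => ?_
  rw [consE_apply, extFin_cons, Fin.prod_univ_succ]
  simp

lemma probSemi_const (m : ℕ) (P : Prop) :
    probSemi m (fun _ => P) = if P then 1 else 0 := by
  unfold probSemi
  split_ifs
  · exact (hasSum_prodW m).tsum_eq
  · simp

lemma probSemi_congr {m : ℕ} {E E' : (ℕ → ℤ × ℤ) → Prop} (h : ∀ f, E f ↔ E' f) :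
    probSemi m E = probSemi m E' := by
  have : E = E' := funext fun f => propext (h f)
  rw [this]

lemma probSemi_false {m : ℕ} {E : (ℕ → ℤ × ℤ) → Prop} (h : ∀ f, ¬ E f) : probSemi m E = 0 := by
  rw [probSemi_congr (E' := fun _ => False) (fun f => by simp [h f]), probSemi_const]
  simp

/-- the chain started from `z` -/
def zf (z : ℤ) (f : ℕ → ℤ × ℤ) : ℕ → ℤ
  | 0 => z
  | l + 1 => zStep (zf z f l) (f l)

lemma zf_zero (f : ℕ → ℤ × ℤ) (k : ℕ) : zbar f k = zf 0 f k := by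
  induction k with
  | zero => rfl
  | succ k ih => simp only [zbar, zf, ih]

lemma zf_ncons (z : ℤ) (d : ℤ × ℤ) (f : ℕ → ℤ × ℤ) (k : ℕ) :
    zf z (ncons d f) (k + 1) = zf (zStep z d) f k := by
  induction k with
  | zero => rfl
  | succ k ih =>
    rw [zf, ih]
    rfl

/-- renewal at time `k` for the chain started from `z` -/
def Rn (z : ℤ) (f : ℕ → ℤ × ℤ) (k : ℕ) : Prop := zf z f (k - 1) < 0 ∧ zf z f k = 1

lemma Rn_zero (z : ℤ) (f : ℕ → ℤ × ℤ) : ¬ Rn z f 0 := by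
  rintro ⟨h1, h2⟩
  simp [zf] at h1 h2
  lia

lemma Rn_one (z : ℤ) (d : ℤ × ℤ) (f : ℕ → ℤ × ℤ) : Rn z (ncons d f) 1 ↔ isReset z d := Iff.rfl

lemma Rn_ncons (z : ℤ) (d : ℤ × ℤ) (f : ℕ → ℤ × ℤ) (k : ℕ) :
    Rn z (ncons d f) (k + 2) ↔ Rn (zStep z d) f (k + 1) := by
  unfold Rn
  have h1 := zf_ncons z d f k
  have h2 := zf_ncons z d f (k + 1)
  simp only [Nat.add_sub_cancel, show k + 2 - 1 = k + 1 from rfl] at *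
  rw [h1, h2]

lemma isRenewal_iff (f : ℕ → ℤ × ℤ) (k : ℕ) : isRenewal f k ↔ Rn 0 f k := by
  simp only [isRenewal, Rn, zf_zero]

lemma prob_Rn (k : ℕ) : ∀ z, probSemi k (fun f => Rn z f k) = aSeq 1 k z := by
  induction k using Nat.strong_induction_on with
  | _ k ih =>
  intro z
  match k with
  | 0 => exact probSemi_false (Rn_zero z)
  | 1 =>
    rw [probSemi_succ, aSeq]
    refine tsum_congr fun d => ?_
    rw [probSemi_congr (E' := fun _ => isReset z d) (fun f => Rn_one z d f), probSemi_const]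
  | k + 2 =>
    rw [probSemi_succ, aSeq]
    refine tsum_congr fun d => ?_
    rw [probSemi_congr (fun f => Rn_ncons z d f k), ih (k + 1) (by lia)]
    simp

lemma prob_first (k : ℕ) : ∀ z, probSemi k (fun f => Rn z f k ∧ ∀ r, 1 ≤ r → r < k → ¬ Rn z f r) =
    aSeq 0 k z := by
  induction k using Nat.strong_induction_on with
  | _ k ih =>
  intro z
  match k with
  | 0 => exact probSemi_false fun f h => Rn_zero z f h.1
  | 1 =>
    rw [probSemi_succ, aSeq]
    refine tsum_congr fun d => ?_
    rw [probSemi_congr (E' := fun _ => isReset z d), probSemi_const]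
    intro f
    rw [Rn_one]
    exact ⟨fun h => h.1, fun h => ⟨h, fun r h1 h2 => by lia⟩⟩
  | k + 2 =>
    rw [probSemi_succ, aSeq]
    refine tsum_congr fun d => ?_
    congr 1
    by_cases hr : isReset z d
    · simp only [hr, if_true, zero_mul]
      exact probSemi_false fun f h => h.2 1 le_rfl (by lia) ((Rn_one z d f).2 hr)
    · simp only [hr, if_false, one_mul]
      rw [← ih (k + 1) (by lia)]
      refine probSemi_congr fun f => ?_
      rw [Rn_ncons]
      refine and_congr_right fun _ => ⟨fun h r h1 h2 => ?_, fun h r h1 h2 => ?_⟩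
      · obtain ⟨r, rfl⟩ := Nat.exists_eq_add_of_le' h1
        rw [← Rn_ncons]
        exact h _ (by lia) (by lia)
      · obtain ⟨r, rfl⟩ := Nat.exists_eq_add_of_le' h1
        cases r with
        | zero => rwa [zero_add, Rn_one]
        | succ r =>
          rw [Rn_ncons]
          exact h _ (by lia) (by lia)

lemma Pτ_one (k : ℕ) : PτSemi 1 k = aSeq 0 k 0 := by
  rw [← prob_first, PτSemi]
  refine probSemi_congr fun f => ?_
  simp only [one_ne_zero, if_false]
  rw [isRenewal_iff]
  refine and_congr_right fun hk => ?_
  have hk0 : 1 ≤ k := by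
    by_contra h
    have : k = 0 := by lia
    subst this
    exact Rn_zero _ _ hk
  unfold renewalCount
  have hmem : k ∈ (Finset.Icc 1 k).filter fun r => isRenewal f r := by
    simp [hk0, isRenewal_iff, hk]
  rw [Finset.card_eq_one]
  constructor
  · rintro ⟨a, ha⟩ r h1 h2 hr
    have hr' : r ∈ (Finset.Icc 1 k).filter fun r => isRenewal f r := by
      simp [h1, h2.le, isRenewal_iff, hr]
    rw [ha, Finset.mem_singleton] at hmem hr'
    lia
  · intro h
    refine ⟨k, Finset.eq_singleton_iff_unique_mem.2 ⟨hmem, fun r hr => ?_⟩⟩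
    simp only [Finset.mem_filter, Finset.mem_Icc, isRenewal_iff] at hr
    by_contra hne
    exact h r hr.1.1 (by lia) hr.2

lemma tsum_Pτ (k : ℕ) (hk : 1 ≤ k) : ∑' l, PτSemi l k = aSeq 1 k 0 := by
  have hcard : ∀ f, renewalCount f k ≤ k := fun f => by
    unfold renewalCount
    refine (Finset.card_filter_le _ _).trans ?_
    simp
  rw [tsum_eq_sum (s := Finset.range (k + 1))]
  · unfold PτSemi probSemi
    rw [← Summable.tsum_finsetSum]
    · rw [← prob_Rn, probSemi]
      refine tsum_congr fun g => ?_
      by_cases hR : Rn 0 (extFin g) k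
      · have hpos : 1 ≤ renewalCount (extFin g) k := by
          unfold renewalCount
          rw [Nat.succ_le_iff, Finset.card_pos]
          exact ⟨k, by simp [hk, isRenewal_iff, hR]⟩
        rw [Finset.sum_eq_single (renewalCount (extFin g) k)]
        · have : renewalCount (extFin g) k ≠ 0 := by lia
          simp [this, isRenewal_iff, hR]
        · intro l _ hl
          rw [if_neg]
          split_ifs
          · lia
          · exact fun h => hl h.2.symm
        · intro h
          have := hcard (extFin g)
          simp at h
          lia
      · rw [if_neg hR]
        refine Finset.sum_eq_zero fun l _ => ?_
        rw [if_neg]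
        split_ifs
        · lia
        · exact fun h => hR ((isRenewal_iff _ _).1 h.1)
    · exact fun l _ => summable_prob k
        (fun f => if l = 0 then k = 0 else (isRenewal f k ∧ renewalCount f k = l))
  · intro l hl
    refine probSemi_false fun f => ?_
    have := hcard f
    simp at hl
    have : l ≠ 0 := by lia
    simp only [this, if_false]
    rintro ⟨_, h⟩
    lia
lemma a_bounds : 0 < semiγ ^ 3 ∧ semiγ ^ 3 ≤ 1 / 4 := by
  refine ⟨pow_pos γ_pos 3, ?_⟩
  rw [← α_eq]
  have : √(5:ℝ) ≤ 9 / 4 := by rw [Real.sqrt_le_left] <;> norm_num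
  unfold semiα; linarith

/-- discriminant root -/
def Rs (s : ℝ) : ℝ := √((1 - s) * (1 - (1 - 4 * semiγ ^ 3) * s))

/-- first passage generating function of the lazy walk -/
def Fs (s : ℝ) : ℝ := (1 - (1 - 2 * semiγ ^ 3) * s - Rs s) / (2 * semiγ ^ 3 * s)

lemma Rs_sq {s : ℝ} (h0 : 0 < s) (h1 : s < 1) :
    Rs s ^ 2 = (1 - s) * (1 - (1 - 4 * semiγ ^ 3) * s) := by
  obtain ⟨a0, a1⟩ := a_bounds
  refine Real.sq_sqrt (mul_nonneg (by linarith) ?_)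
  nlinarith

lemma Rs_pos {s : ℝ} (h0 : 0 < s) (h1 : s < 1) : 0 < Rs s := by
  obtain ⟨a0, a1⟩ := a_bounds
  refine Real.sqrt_pos.2 (mul_pos (by linarith) ?_)
  nlinarith

lemma Fs_mul {s : ℝ} (h0 : 0 < s) :
    2 * semiγ ^ 3 * (s * Fs s) = 1 - (1 - 2 * semiγ ^ 3) * s - Rs s := by
  obtain ⟨a0, a1⟩ := a_bounds
  have := γ_pos
  unfold Fs
  field_simp

lemma Fs_pos {s : ℝ} (h0 : 0 < s) (h1 : s < 1) : 0 < Fs s := by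
  obtain ⟨a0, a1⟩ := a_bounds
  have hR := Rs_sq h0 h1
  have hR0 := Rs_pos h0 h1
  refine div_pos ?_ (by positivity)
  have hL : 0 < 1 - (1 - 2 * semiγ ^ 3) * s := by nlinarith
  have : Rs s < 1 - (1 - 2 * semiγ ^ 3) * s := by
    refine lt_of_pow_lt_pow_left₀ 2 hL.le ?_
    rw [hR]
    nlinarith [pow_pos a0 2, pow_pos (mul_pos a0 h0) 2]
  linarith

lemma Fs_lt_one {s : ℝ} (h0 : 0 < s) (h1 : s < 1) : Fs s < 1 := by
  obtain ⟨a0, a1⟩ := a_bounds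
  have hR := Rs_sq h0 h1
  have hR0 := Rs_pos h0 h1
  unfold Fs
  rw [div_lt_one (by positivity)]
  have : 1 - s < Rs s := by
    refine lt_of_pow_lt_pow_left₀ 2 hR0.le ?_
    rw [hR]
    have : 0 < (1 - s) * (4 * semiγ ^ 3 * s) := mul_pos (by linarith) (by positivity)
    nlinarith
  linarith

lemma Fs_quad {s : ℝ} (h0 : 0 < s) (h1 : s < 1) :
    semiγ ^ 3 * s * Fs s ^ 2 = (1 - (1 - 2 * semiγ ^ 3) * s) * Fs s - semiγ ^ 3 * s := by
  obtain ⟨a0, a1⟩ := a_bounds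
  have hR := Rs_sq h0 h1
  have hF := Fs_mul h0
  have h4 : 4 * semiγ ^ 3 * s ≠ 0 := by positivity
  apply mul_left_cancel₀ h4
  have hR' : Rs s = 1 - (1 - 2 * semiγ ^ 3) * s - 2 * semiγ ^ 3 * (s * Fs s) := by linarith
  rw [hR'] at hR
  linear_combination hR

lemma Fs_key {s : ℝ} (h0 : 0 < s) (h1 : s < 1) :
    Fs s = s * semiγ ^ 2 * (Fs s + semiγ) * (1 + semiγ * Fs s) := by
  have h := Fs_quad h0 h1
  have e : semiγ ^ 2 + semiγ ^ 4 + 2 * semiγ ^ 3 = 1 := by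
    linear_combination (semiγ ^ 2 + semiγ + 1) * γ_sq
  linear_combination -h - s * Fs s * e

lemma gf_first {s : ℝ} (h0 : 0 < s) (h1 : s < 1) :
    HasSum (fun k => aSeq 0 k 0 * s ^ k) (s * (semiγ * Fs s ^ 2 + semiγ ^ 2 * Fs s)) := by
  have h := aSeq_gf (θ := 0) (C := 1) le_rfl zero_le_one h0 h1 (Fs_pos h0 h1) (Fs_lt_one h0 h1)
    (Fs_key h0 h1) (by simp) 0
  rwa [Vf_zero, one_mul] at h

lemma gf_all {s : ℝ} (h0 : 0 < s) (h1 : s < 1) :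
    HasSum (fun k => aSeq 1 k 0 * s ^ k) (semiγ ^ 2 * semiγ ^ 3 * (s * (s * (1 / Rs s))) +
      semiγ / 2 * (s * ((1 - (1 - 2 * semiγ ^ 3) * s) * (1 / Rs s) - 1))) := by
  obtain ⟨a0, a1⟩ := a_bounds
  have p := Fs_pos h0 h1
  have l := Fs_lt_one h0 h1
  have hne : 1 - Fs s ^ 2 ≠ 0 := by nlinarith
  have h := aSeq_gf (θ := 1) (C := 1 / (1 - Fs s ^ 2)) zero_le_one le_rfl h0 h1 p l
    (Fs_key h0 h1) (by field_simp; ring) 0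
  rw [Vf_zero] at h
  have hR0 := Rs_pos h0 h1
  have hF := Fs_mul h0
  have q := Fs_quad h0 h1
  have e1 : semiγ ^ 3 * s * (1 - Fs s ^ 2) = Rs s * Fs s := by
    linear_combination q - Fs s * hF
  have e2 : Fs s / (1 - Fs s ^ 2) = semiγ ^ 3 * s / Rs s := by
    rw [div_eq_div_iff hne hR0.ne']
    linear_combination -e1
  convert h using 1
  have e3 : 1 / (1 - Fs s ^ 2) * (s * (semiγ * Fs s ^ 2 + semiγ ^ 2 * Fs s)) =
    s * (semiγ * Fs s + semiγ ^ 2) * (Fs s / (1 - Fs s ^ 2)) := by ring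
  rw [e3, e2]
  field_simp
  linear_combination -semiγ * hF

/-- the power series of `1/R` -/
def PS : PowerSeries ℝ := PowerSeries.mk (pN (1 - 4 * semiγ ^ 3))

lemma PS_gf : GFun PS (fun s => 1 / Rs s) := by
  intro s h0 h1
  obtain ⟨a0, a1⟩ := a_bounds
  simpa [PS] using! pN_hasSum (ρ := 1 - 4 * semiγ ^ 3) (by linarith) (by linarith) h0.le h1

lemma all_eq : PowerSeries.mk (fun k => aSeq 1 k 0) =
    (semiγ ^ 2 * semiγ ^ 3) • (PowerSeries.X * (PowerSeries.X * PS)) +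
    (semiγ / 2) • (PowerSeries.X * (PS + (-(1 - 2 * semiγ ^ 3)) • (PowerSeries.X * PS) +
      (-1 : ℝ) • 1)) := by
  refine GFun.unique (φ := _) (ψ := _) (fun s h0 h1 => by simpa using! gf_all h0 h1)
    ((PS_gf.X_mul.X_mul.smul _).add
      (((PS_gf.add (PS_gf.X_mul.smul _)).add (GFun.one.smul _)).X_mul.smul _)) ?_
  intro s h0 h1
  ring

lemma all_coeff (k : ℕ) : aSeq 1 (k + 2) 0 =
    semiγ ^ 2 * semiγ ^ 3 * pN (1 - 4 * semiγ ^ 3) k + semiγ / 2 *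
      (pN (1 - 4 * semiγ ^ 3) (k + 1) - (1 - 2 * semiγ ^ 3) * pN (1 - 4 * semiγ ^ 3) k) := by
  have h := congrArg (PowerSeries.coeff (k + 2)) all_eq
  simp only [PowerSeries.coeff_mk, map_add, map_smul, PowerSeries.coeff_succ_X_mul, PS,
    PowerSeries.coeff_one, smul_eq_mul] at h
  rw [h, if_neg (Nat.succ_ne_zero _)]
  ring

/-- the power series of `s F(s)` -/
def GS : PowerSeries ℝ := (1 / (2 * semiγ ^ 3)) • (1 + (-(1 - 2 * semiγ ^ 3)) • (PowerSeries.X * 1) +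
  (-1 : ℝ) • (PS + (-(2 - 4 * semiγ ^ 3)) • (PowerSeries.X * PS) +
    (1 - 4 * semiγ ^ 3) • (PowerSeries.X * (PowerSeries.X * PS))))

lemma GS_gf : GFun GS (fun s => s * Fs s) := by
  intro s h0 h1
  have h := ((GFun.one.add (GFun.one.X_mul.smul (-(1 - 2 * semiγ ^ 3)))).add
    (((PS_gf.add (PS_gf.X_mul.smul (-(2 - 4 * semiγ ^ 3)))).add
      (PS_gf.X_mul.X_mul.smul (1 - 4 * semiγ ^ 3))).smul (-1))).smul (1 / (2 * semiγ ^ 3)) s h0 h1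
  have e : s * Fs s = 1 / (2 * semiγ ^ 3) * (1 + -(1 - 2 * semiγ ^ 3) * (s * 1) +
      -1 * (1 / Rs s + -(2 - 4 * semiγ ^ 3) * (s * (1 / Rs s)) +
        (1 - 4 * semiγ ^ 3) * (s * (s * (1 / Rs s))))) := by
    obtain ⟨a0, a1⟩ := a_bounds
    have hF := Fs_mul h0
    have hR := Rs_sq h0 h1
    have hR0 := Rs_pos h0 h1
    have hR2 : Rs s = (1 - s) * (1 - (1 - 4 * semiγ ^ 3) * s) * (1 / Rs s) := by
      field_simp; linarith
    have h2 : 2 * semiγ ^ 3 ≠ 0 := by positivity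
    apply mul_left_cancel₀ h2
    rw [← mul_assoc (2 * semiγ ^ 3) (1 / (2 * semiγ ^ 3)), mul_one_div_cancel h2]
    linear_combination hF - hR2
  simp only [e]
  exact h

lemma first_eq : PowerSeries.X * PowerSeries.mk (fun k => aSeq 0 k 0) =
    (semiγ / semiγ ^ 3) • (GS + (-(1 - 2 * semiγ ^ 3)) • (PowerSeries.X * GS)) +
    (-semiγ) • (PowerSeries.X * (PowerSeries.X * 1)) +
    (semiγ ^ 2) • (PowerSeries.X * GS) := by
  have hA : GFun (PowerSeries.mk (fun k => aSeq 0 k 0))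
    (fun s => s * (semiγ * Fs s ^ 2 + semiγ ^ 2 * Fs s)) :=
    fun s h0 h1 => by simpa using! gf_first h0 h1
  refine GFun.unique hA.X_mul (((((GS_gf.add (GS_gf.X_mul.smul _)).smul _)).add
    (GFun.one.X_mul.X_mul.smul _)).add (GS_gf.X_mul.smul _)) ?_
  intro s h0 h1
  have q := Fs_quad h0 h1
  have hγ := γ_pos
  field_simp
  linear_combination q

lemma GS_coeff (k : ℕ) : PowerSeries.coeff (k + 2) GS = -(1 / (2 * semiγ ^ 3)) *
    (pN (1 - 4 * semiγ ^ 3) (k + 2) - (2 - 4 * semiγ ^ 3) * pN (1 - 4 * semiγ ^ 3) (k + 1) +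
      (1 - 4 * semiγ ^ 3) * pN (1 - 4 * semiγ ^ 3) k) := by
  simp only [GS, PowerSeries.coeff_mk, map_add, map_smul, PowerSeries.coeff_succ_X_mul, PS,
    PowerSeries.coeff_one, smul_eq_mul]
  simp
  ring

lemma first_coeff (k : ℕ) : aSeq 0 (k + 2) 0 =
    (semiγ / semiγ ^ 3) * (PowerSeries.coeff (k + 3) GS
      - (1 - 2 * semiγ ^ 3) * PowerSeries.coeff (k + 2) GS) +
    semiγ ^ 2 * PowerSeries.coeff (k + 2) GS := by
  have h := congrArg (PowerSeries.coeff (k + 3)) first_eq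
  simp only [PowerSeries.coeff_mk, map_add, map_smul, PowerSeries.coeff_succ_X_mul,
    PowerSeries.coeff_one, smul_eq_mul] at h
  rw [h, if_neg (Nat.succ_ne_zero _)]
  ring

lemma tendsto_sqrt_shift {x : ℕ → ℝ} {l : ℝ} (h : Tendsto (fun n : ℕ => √n * x n) atTop (𝓝 l))
    (i j : ℕ) : Tendsto (fun n : ℕ => √((n + (i + j) : ℕ) : ℝ) * x (n + i)) atTop (𝓝 l) := by
  have h0 : Tendsto (fun n : ℕ => √((n + j : ℕ) : ℝ) * x n) atTop (𝓝 l) := by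
    have hr : Tendsto (fun n : ℕ => √(((n + j : ℕ) : ℝ) / n)) atTop (𝓝 1) := by
      have : Tendsto (fun n : ℕ => ((n + j : ℕ) : ℝ) / n) atTop (𝓝 1) := by
        have h2 : Tendsto (fun n : ℕ => 1 + (j : ℝ) / n) atTop (𝓝 (1 + 0)) :=
          tendsto_const_nhds.add (tendsto_const_div_atTop_nhds_zero_nat _)
        rw [add_zero] at h2
        refine h2.congr' ?_
        filter_upwards [eventually_gt_atTop 0] with n hn
        have : (n : ℝ) ≠ 0 := by positivity
        push_cast; field_simp
      have h3 := (Real.continuous_sqrt.tendsto _).comp this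
      rw [Real.sqrt_one] at h3
      exact h3
    have := hr.mul h
    rw [one_mul] at this
    refine this.congr' ?_
    filter_upwards [eventually_gt_atTop 0] with n hn
    have : 0 < √(n : ℝ) := by positivity
    rw [Real.sqrt_div (by positivity)]
    field_simp
  refine ((tendsto_add_atTop_iff_nat i).2 h0).congr fun n => ?_
  rw [add_assoc]

lemma const_eq : √(1 / Real.pi) * (1 / √(1 - (1 - 4 * semiγ ^ 3))) * semiγ ^ 3 *
    (semiβ * (2 * Real.pi)) = 1 := by
  have h0 := γ_pos
  have hs := γ_sq
  have h5 : √(5:ℝ) = 2 * semiγ + 1 := by unfold semiγ; ring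
  set t := √semiγ with ht
  have t0 : 0 < t := Real.sqrt_pos.2 h0
  have tt : t ^ 2 = semiγ := Real.sq_sqrt h0.le
  have e1 : √(1 - (1 - 4 * semiγ ^ 3)) = 2 * t ^ 3 := by
    rw [← tt, Real.sqrt_eq_iff_mul_self_eq_of_pos (by positivity)]
    ring
  have q0 : 0 < √(2:ℝ) := by positivity
  have q2 : √(2:ℝ) ^ 2 = 2 := Real.sq_sqrt (by norm_num)
  have e2 : semiσ' = √2 / t := by
    unfold semiσ'
    rw [Real.sqrt_eq_iff_mul_self_eq_of_pos (by positivity), div_mul_div_comm, ← pow_two, ← pow_two, q2, tt, h5]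
    field_simp
    linear_combination -2 * hs
  have e3 : semiσ = √2 / t ^ 3 := by
    unfold semiσ
    rw [Real.sqrt_eq_iff_mul_self_eq_of_pos (by positivity), div_mul_div_comm, ← pow_two, ← pow_two, q2,
      show (t ^ 3) ^ 2 = (t ^ 2) ^ 3 by ring, tt, h5]
    field_simp
    linear_combination (-2 * semiγ ^ 2 - semiγ - 1) * hs
  have p0 : 0 < √Real.pi := Real.sqrt_pos.2 Real.pi_pos
  have pp : Real.pi = √Real.pi ^ 2 := (Real.sq_sqrt Real.pi_pos.le).symm
  have e4 : √(1 / Real.pi) = 1 / √Real.pi := by simp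
  have e5 : √(2 * Real.pi) = √2 * √Real.pi := Real.sqrt_mul (by norm_num) _
  unfold semiβ
  rw [e1, e2, e3, e4, e5, ← hs]
  generalize √Real.pi = q at *
  rw [pp, ← tt]
  rw [← tt] at hs
  field_simp
  rw [q2]
  linear_combination hs

theorem semi_baxter_renewal_asymptotics :
    Filter.Tendsto (fun k : ℕ => Real.sqrt k * PτSemi 1 k) Filter.atTop (nhds 0) ∧
    Filter.Tendsto
      (fun k : ℕ => (∑' ℓ : ℕ, PτSemi ℓ k) / (1 / (semiβ * (2 * Real.pi * Real.sqrt k))))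
      Filter.atTop (nhds 1) := by
  obtain ⟨a0, a1⟩ := a_bounds
  have hp := pN_tendsto (ρ := 1 - 4 * semiγ ^ 3) (by linarith) (by linarith)
  have hc := const_eq
  generalize √(1 / Real.pi) * (1 / √(1 - (1 - 4 * semiγ ^ 3))) = c at hp hc
  constructor
  · rw [← tendsto_add_atTop_iff_nat 2]
    have t0 := tendsto_sqrt_shift hp 0 3
    have t1 := tendsto_sqrt_shift hp 1 2
    have t2 := tendsto_sqrt_shift hp 2 1
    have t3 := tendsto_sqrt_shift hp 3 0
    norm_num only [] at t0 t1 t2 t3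
    have g2 : Tendsto (fun n : ℕ => √((n + 3 : ℕ) : ℝ) * PowerSeries.coeff (n + 2) GS) atTop (𝓝 0) := by
      have := ((t2.sub (t1.const_mul (2 - 4 * semiγ ^ 3))).add
        (t0.const_mul (1 - 4 * semiγ ^ 3))).const_mul (-(1 / (2 * semiγ ^ 3)))
      have e : -(1 / (2 * semiγ ^ 3)) * (c - (2 - 4 * semiγ ^ 3) * c + (1 - 4 * semiγ ^ 3) * c) = 0 := by
        ring
      rw [e] at this
      refine this.congr fun n => ?_
      rw [GS_coeff]; ring
    have g3 : Tendsto (fun n : ℕ => √((n + 3 : ℕ) : ℝ) * PowerSeries.coeff (n + 3) GS) atTop (𝓝 0) := by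
      have := ((t3.sub (t2.const_mul (2 - 4 * semiγ ^ 3))).add
        (t1.const_mul (1 - 4 * semiγ ^ 3))).const_mul (-(1 / (2 * semiγ ^ 3)))
      have e : -(1 / (2 * semiγ ^ 3)) * (c - (2 - 4 * semiγ ^ 3) * c + (1 - 4 * semiγ ^ 3) * c) = 0 := by
        ring
      rw [e] at this
      refine this.congr fun n => ?_
      rw [GS_coeff (n + 1)]; ring
    have h3 : Tendsto (fun n : ℕ => √((n + 3 : ℕ) : ℝ) * aSeq 0 (n + 2) 0) atTop (𝓝 0) := by
      have := ((g3.sub (g2.const_mul (1 - 2 * semiγ ^ 3))).const_mul (semiγ / semiγ ^ 3)).add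
        (g2.const_mul (semiγ ^ 2))
      simp only [mul_zero, sub_zero, add_zero] at this
      refine this.congr fun n => ?_
      rw [first_coeff]; ring
    refine squeeze_zero (fun n => ?_) (fun n => ?_) h3
    · rw [Pτ_one]
      exact mul_nonneg (Real.sqrt_nonneg _) (aSeq_nonneg le_rfl _ _)
    · rw [Pτ_one]
      refine mul_le_mul_of_nonneg_right (Real.sqrt_le_sqrt ?_) (aSeq_nonneg le_rfl _ _)
      push_cast; linarith
  · rw [← tendsto_add_atTop_iff_nat 2]
    have t0 := tendsto_sqrt_shift hp 0 2
    have t1 := tendsto_sqrt_shift hp 1 1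
    norm_num only [] at t0 t1
    have := ((t0.const_mul (semiγ ^ 2 * semiγ ^ 3)).add
      ((t1.sub (t0.const_mul (1 - 2 * semiγ ^ 3))).const_mul (semiγ / 2))).mul_const
        (semiβ * (2 * Real.pi))
    have e : (semiγ ^ 2 * semiγ ^ 3 * c + semiγ / 2 * (c - (1 - 2 * semiγ ^ 3) * c)) *
        (semiβ * (2 * Real.pi)) = 1 := by
      linear_combination hc + (c * semiγ ^ 3 * (semiβ * (2 * Real.pi))) * γ_sq
    rw [e] at this
    refine this.congr fun n => ?_
    rw [tsum_Pτ _ (by lia), all_coeff]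
    simp only [one_div, div_inv_eq_mul]
    ring
end
end
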